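/- arXiv:1007.1276 — 2 statements merged into one kernel-verified Lean document; each statement's English description precedes it below -/
import Mathlib

section
/- Entropy production estimate (Theorem 3, coercive part). There exists a constant C > 0, depending only on n, s, γ, C_Φ, c_b, R and δ, such that the following holds. For every kernel b satisfying the standing kernel assumptions, every nonnegative measurable g : ℝⁿ → [0,∞) integrable on B_R and satisfying Assumption L with constants R > δ > 0 and C̃_g > 0, and every measurable f : ℝⁿ → ℝ with f(v) > 0 for all v, the nonnegative part of the entropy production, S(g,f) := ∫∫∫ B(v-v_*,σ) g(v_*) · ( f(v) log(f(v)/f(v')) - f(v) + f(v') ) dσ dv_* dv (the integrand is nonnegative, so the integral is a well-defined value in [0,∞]), satisfies (∫_{B_R} g) · S(g,f) ≥ C · C̃_g² · |√f|²_{Ṅ^{s,γ}}. -/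
open MeasureTheory Real Set Metric
open scoped ENNReal RealInnerProductSpace

noncomputable section

/-- `ℝⁿ` with the Euclidean structure. -/
abbrev V (n : ℕ) := EuclideanSpace ℝ (Fin n)

/-- the Japanese bracket `⟨v⟩ = √(1+|v|²)`. -/
def jap {n : ℕ} (v : V n) : ℝ := Real.sqrt (1 + ‖v‖ ^ 2)

/-- the post-collisional velocity `v' = (v+v_*)/2 + (|v-v_*|/2)σ`. -/
def vprime {n : ℕ} (v vs σ : V n) : V n :=
  (2:ℝ)⁻¹ • (v + vs) + (‖v - vs‖ / 2) • σ

/-- the anisotropic metric `d(v,v') = √(|v-v'|² + ¼(|v|²-|v'|²)²)` on the lifted paraboloid. -/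
def anisoDist {n : ℕ} (v v' : V n) : ℝ :=
  Real.sqrt (‖v - v'‖ ^ 2 + 4⁻¹ * (‖v‖ ^ 2 - ‖v'‖ ^ 2) ^ 2)

/-- The standing assumptions on the angular kernel `b`: measurability, nonnegativity,
vanishing for deviation angles `θ ∈ (π/2, π]`, and the two-sided power bound
`c_b θ^{-(1+2s)} ≤ sin^{n-2}θ · b(cos θ) ≤ c_b⁻¹ θ^{-(1+2s)}` on `(0, π/2]`. -/
def KernelAssumptions (n : ℕ) (s cb : ℝ) (b : ℝ → ℝ) : Prop :=
  Measurable b ∧ (∀ t : ℝ, 0 ≤ b t) ∧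
  (∀ θ : ℝ, θ ∈ Set.Ioc (π / 2) π → b (Real.cos θ) = 0) ∧
  (∀ θ : ℝ, θ ∈ Set.Ioc 0 (π / 2) →
    cb * θ ^ (-(1 + 2 * s)) ≤ Real.sin θ ^ ((n : ℝ) - 2) * b (Real.cos θ) ∧
    Real.sin θ ^ ((n : ℝ) - 2) * b (Real.cos θ) ≤ cb⁻¹ * θ ^ (-(1 + 2 * s)))

/-- The Boltzmann collision kernel `B(v-v_*,σ) = C_Φ |v-v_*|^γ b(⟨(v-v_*)/|v-v_*|, σ⟩)`. -/
def Bker {n : ℕ} (CΦ γ : ℝ) (b : ℝ → ℝ) (v vs σ : V n) : ℝ :=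
  CΦ * ‖v - vs‖ ^ γ * b ⟪‖v - vs‖⁻¹ • (v - vs), σ⟫

/-- the surface measure on the unit sphere `S^{n-1}`. -/
def sphMeas (n : ℕ) : Measure (Metric.sphere (0 : V n) 1) :=
  (volume : Measure (V n)).toSphere

/-- the anisotropic seminorm `|f|²_{Ṅ^{s,γ}}`, as a value in `[0,∞]`. -/
def NdotSq {n : ℕ} (s γ : ℝ) (f : V n → ℝ) : ℝ≥0∞ :=
  ∫⁻ v : V n, ∫⁻ v' : V n, (if anisoDist v v' ≤ 1 then
    ENNReal.ofReal ((jap v * jap v') ^ ((γ + 2 * s + 1) / 2) * (f v' - f v) ^ 2 *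
      anisoDist v v' ^ (-((n : ℝ) + 2 * s))) else 0)

/-- `T` is a tube of radius `δ` around some affine line of `ℝⁿ`. -/
def IsTube {n : ℕ} (δ : ℝ) (T : Set (V n)) : Prop :=
  ∃ p u : V n, u ≠ 0 ∧ T = {x | Metric.infDist x {y | ∃ t : ℝ, y = p + t • u} ≤ δ}

/-- Assumption L: `∫_{B_R ∖ T} g ≥ C̃_g` for every tube `T` of radius `δ`. -/
def AssumptionL {n : ℕ} (R δ Cg : ℝ) (g : V n → ℝ) : Prop :=
  ∀ T : Set (V n), IsTube δ T →
    ENNReal.ofReal Cg ≤ ∫⁻ x in Metric.closedBall (0 : V n) R \ T, ENNReal.ofReal (g x)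

/-- the nonnegative part `S(g,f)` of the entropy production, as a value in `[0,∞]`. -/
def EntS {n : ℕ} (CΦ γ : ℝ) (b : ℝ → ℝ) (g f : V n → ℝ) : ℝ≥0∞ :=
  ∫⁻ v : V n, ∫⁻ vs : V n, ∫⁻ σ : Metric.sphere (0 : V n) 1,
    ENNReal.ofReal (Bker CΦ γ b v vs σ * g vs *
      (f v * Real.log (f v / f (vprime v vs σ)) - f v + f (vprime v vs σ)))
      ∂(sphMeas n)

lemma lintegral_polar {m : ℕ} (h : V (m+1) → ℝ≥0∞) (hh : Measurable h) :
    ∫⁻ x, h x = ∫⁻ ω : sphere (0 : V (m+1)) 1, (∫⁻ r in Ioi (0:ℝ),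
      ENNReal.ofReal (r ^ m) * h (r • (ω : V (m+1)))) ∂(sphMeas (m+1)) := by
  have hmp := (volume : Measure (V (m+1))).measurePreserving_homeomorphUnitSphereProd
  have hfr : Module.finrank ℝ (V (m+1)) - 1 = m := by simp
  rw [hfr] at hmp
  have h1 : ∫⁻ x, h x = ∫⁻ x : ({0}ᶜ : Set (V (m+1))), h x ∂((volume : Measure (V (m+1))).comap (↑)) := by
    rw [lintegral_subtype_comap (measurableSet_singleton (0:V (m+1))).compl]
    rw [restrict_compl_singleton]
  have h2 : ∫⁻ x : ({0}ᶜ : Set (V (m+1))), h x ∂((volume : Measure (V (m+1))).comap (↑))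
     = ∫⁻ p : sphere (0 : V (m+1)) 1 × Ioi (0:ℝ), h (p.2.1 • (p.1 : V (m+1)))
        ∂((volume : Measure (V (m+1))).toSphere.prod (Measure.volumeIoiPow m)) := by
    rw [← hmp.lintegral_comp_emb (Homeomorph.measurableEmbedding _)]
    refine lintegral_congr fun x => ?_
    congr 1
    have hx : ‖(x : V (m+1))‖ ≠ 0 := norm_ne_zero_iff.2 x.2
    simp [smul_smul, hx]
  rw [h1, h2, lintegral_prod _ (by fun_prop)]
  unfold sphMeas
  refine lintegral_congr fun ω => ?_
  rw [Measure.volumeIoiPow, lintegral_withDensity_eq_lintegral_mul _ (by fun_prop) (by fun_prop)]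
  simp only [Pi.mul_apply]
  rw [lintegral_subtype_comap measurableSet_Ioi (fun r : ℝ => ENNReal.ofReal (r ^ m) * h (r • (ω : V (m+1))))]

lemma exists_decomp {m : ℕ} (k : V (m+1)) (hk : ‖k‖ = 1) :
    ∃ L : V m →ₗᵢ[ℝ] V (m+1), (∀ y, ⟪k, L y⟫ = 0) ∧ (∀ x, ∃ t : ℝ, ∃ y, x = t • k + L y) ∧
      ∀ h : V (m+1) → ℝ≥0∞, Measurable h →
        ∫⁻ x, h x = ∫⁻ t : ℝ, ∫⁻ y : V m, h (t • k + L y) := by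
  let v : Fin (m+1) → V (m+1) := fun _ => k
  have hv : Orthonormal ℝ (({0} : Set (Fin (m+1))).domRestrict v) := by
    constructor
    · intro i; exact hk
    · intro i j hij
      exact absurd (Subsingleton.elim i j) hij
  obtain ⟨b, hb⟩ := hv.exists_orthonormalBasis_extension_of_card_eq (by simp)
  have hb0 : b 0 = k := hb 0 (by simp)
  have hon := b.orthonormal
  let L0 : V m →ₗ[ℝ] V (m+1) :=
    { toFun := fun y => b.repr.symm (WithLp.toLp 2 (Fin.cons 0 y.ofLp : Fin (m+1) → ℝ))
      map_add' := by
        intro x y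
        rw [← map_add]; congr 1
        ext i
        refine Fin.cases ?_ (fun j => ?_) i <;> simp
      map_smul' := by
        intro c x
        rw [RingHom.id_apply, ← map_smul]; congr 1
        ext i
        refine Fin.cases ?_ (fun j => ?_) i <;> simp }
  let L : V m →ₗᵢ[ℝ] V (m+1) :=
    { toLinearMap := L0
      norm_map' := by
        intro x
        change ‖b.repr.symm _‖ = _
        rw [LinearIsometryEquiv.norm_map, EuclideanSpace.norm_eq, EuclideanSpace.norm_eq]
        simp [Fin.sum_univ_succ] }
  have hcons : ∀ t : ℝ, ∀ y : V m, t • k + L y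
      = b.repr.symm (WithLp.toLp 2 (Fin.cons t y.ofLp : Fin (m+1) → ℝ)) := by
    intro t y
    change t • k + b.repr.symm _ = _
    rw [← hb0]
    apply b.repr.injective
    rw [map_add, map_smul]
    ext i
    refine Fin.cases ?_ (fun j => ?_) i <;> simp
  refine ⟨L, ?_, ?_, ?_⟩
  · intro y
    have h0 : L y = b.repr.symm (WithLp.toLp 2 (Fin.cons 0 y.ofLp : Fin (m+1) → ℝ)) := rfl
    rw [← hb0, h0, ← OrthonormalBasis.repr_apply_apply]
    simp
  · intro x
    refine ⟨b.repr x 0, WithLp.toLp 2 (fun i => b.repr x i.succ), ?_⟩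
    rw [hcons]
    apply b.repr.injective
    ext i
    refine Fin.cases ?_ (fun j => ?_) i <;> simp
  · intro h hh
    have e1 := (b.measurePreserving_repr_symm).lintegral_comp hh
    have e2 := (PiLp.volume_preserving_toLp (Fin (m+1))).lintegral_comp
      (f := fun x => h (b.repr.symm x)) (by fun_prop)
    have e3 := ((volume_preserving_piFinSuccAbove (fun _ : Fin (m+1) => ℝ) 0).symm).lintegral_comp
      (f := fun x => h (b.repr.symm (WithLp.toLp 2 x))) (by fun_prop)
    rw [← e1, ← e2, ← e3]
    rw [Measure.volume_eq_prod, lintegral_prod _ (by fun_prop)]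
    refine lintegral_congr fun t => ?_
    have e4 := (PiLp.volume_preserving_ofLp (Fin m)).lintegral_comp
      (f := fun y : Fin m → ℝ => h (b.repr.symm (WithLp.toLp 2
        ((MeasurableEquiv.piFinSuccAbove (fun _ : Fin (m+1) => ℝ) 0).symm (t, y))))) (by fun_prop)
    rw [← e4]
    refine lintegral_congr fun y => ?_
    rw [hcons]
    congr 3
    simp [MeasurableEquiv.piFinSuccAbove, Fin.insertNthEquiv]

/-- spherical coordinates on the sphere with axis `k`. -/
lemma sphere_coords {j : ℕ} (k : V (j+2)) (hk : ‖k‖ = 1) :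
    ∃ L : V (j+1) →ₗᵢ[ℝ] V (j+2), (∀ y, ⟪k, L y⟫ = 0) ∧
      ∀ h : V (j+2) → ℝ≥0∞, Measurable h →
        ∫⁻ σ : sphere (0 : V (j+2)) 1, h σ ∂(sphMeas (j+2)) =
          ∫⁻ η : sphere (0 : V (j+1)) 1, (∫⁻ θ in Ioo 0 π, ENNReal.ofReal (sin θ ^ j) *
            h (cos θ • k + sin θ • L η)) ∂(sphMeas (j+1)) := by
  obtain ⟨L, hL, -, hd⟩ := exists_decomp k hk
  refine ⟨L, hL, fun h hh => ?_⟩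
  have : IsFiniteMeasure (sphMeas (j+1)) := by unfold sphMeas; infer_instance
  have : IsFiniteMeasure (sphMeas (j+2)) := by unfold sphMeas; infer_instance
  let ψ : ℝ → ℝ≥0∞ := (Ioo (0:ℝ) 1).indicator 1
  have hψ : Measurable ψ := measurable_const.indicator measurableSet_Ioo
  let c : ℝ≥0∞ := ∫⁻ r in Ioi (0:ℝ), ENNReal.ofReal (r ^ (j+1)) * ψ r
  have hc : c = ∫⁻ r in Ioo (0:ℝ) 1, ENNReal.ofReal (r ^ (j+1)) := by
    simp only [c, ψ]
    rw [← lintegral_indicator measurableSet_Ioi, ← lintegral_indicator measurableSet_Ioo]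
    refine lintegral_congr fun r => ?_
    by_cases h1 : r ∈ Ioo (0:ℝ) 1
    · simp [h1, show 0 < r from h1.1]
    · simp [h1]
  have hc0 : c ≠ 0 := by
    rw [hc]
    refine ne_of_gt ?_
    rw [setLIntegral_pos_iff (by fun_prop)]
    refine lt_of_lt_of_le ?_ (measure_mono (s := Ioo (0:ℝ) 1) ?_)
    · simp
    · intro r hr
      refine ⟨?_, hr⟩
      simp only [Function.mem_support, ne_eq, ENNReal.ofReal_eq_zero, not_le]
      exact pow_pos hr.1 _
  have hct : c ≠ ⊤ := by
    rw [hc]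
    refine ne_of_lt (lt_of_le_of_lt (setLIntegral_mono (g := fun _ => 1) measurable_const ?_) ?_)
    · intro r hr
      rw [ENNReal.ofReal_le_one]
      exact pow_le_one₀ hr.1.le hr.2.le
    · simp
  let H : V (j+2) → ℝ≥0∞ := fun x => h (‖x‖⁻¹ • x) * ψ ‖x‖
  have hH : Measurable H := by fun_prop
  have e1 : ∫⁻ x, H x = (∫⁻ σ : sphere (0 : V (j+2)) 1, h σ ∂(sphMeas (j+2))) * c := by
    rw [lintegral_polar H hH, ← lintegral_mul_const _ (by fun_prop)]
    refine lintegral_congr fun ω => ?_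
    rw [← lintegral_const_mul _ (by fun_prop)]
    refine setLIntegral_congr_fun measurableSet_Ioi fun r (hr : 0 < r) => ?_
    have hω : ‖(ω : V (j+2))‖ = 1 := by simp
    simp only [H, norm_smul, hω, mul_one, norm_eq_abs, abs_of_pos hr, smul_smul,
      inv_mul_cancel₀ hr.ne', one_smul]
    ring
  have e2 : ∫⁻ x, H x = (∫⁻ η : sphere (0 : V (j+1)) 1, (∫⁻ θ in Ioo 0 π,
      ENNReal.ofReal (sin θ ^ j) *
            h (cos θ • k + sin θ • L η)) ∂(sphMeas (j+1))) * c := by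
    rw [hd H hH]
    have : ∀ t : ℝ, ∫⁻ y : V (j+1), H (t • k + L y) =
       ∫⁻ ω : sphere (0 : V (j+1)) 1, (∫⁻ r in Ioi (0:ℝ),
      ENNReal.ofReal (r ^ j) * H (t • k + r • L (ω : V (j+1)))) ∂(sphMeas (j+1)) := by
      intro t
      rw [lintegral_polar (fun y => H (t • k + L y)) (by fun_prop)]
      simp only [map_smul]
    simp only [this]
    rw [lintegral_lintegral_swap]
    swap
    · refine Measurable.aemeasurable ?_
      refine Measurable.lintegral_prod_right' (f := fun p : (ℝ × sphere (0 : V (j+1)) 1) × ℝ =>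
        ENNReal.ofReal (p.2 ^ j) * H (p.1.1 • k + p.2 • L (p.1.2 : V (j+1)))) (by fun_prop)
    rw [← lintegral_mul_const]
    swap
    · refine Measurable.lintegral_prod_right' (f := fun p : (sphere (0 : V (j+1)) 1) × ℝ =>
        ENNReal.ofReal (sin p.2 ^ j) * h (cos p.2 • k + sin p.2 • L (p.1 : V (j+1)))) (by fun_prop)
    refine lintegral_congr fun η => ?_
    have hη : ‖(η : V (j+1))‖ = 1 := by simp
    let G : ℝ × ℝ → ℝ≥0∞ := fun p => (Ioi (0:ℝ)).indicator (fun r =>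
      ENNReal.ofReal (r ^ j) * H (p.1 • k + r • L (η : V (j+1)))) p.2
    have hG : Measurable G := by
      have : G = (univ ×ˢ Ioi (0:ℝ)).indicator (fun p : ℝ × ℝ =>
        ENNReal.ofReal (p.2 ^ j) * H (p.1 • k + p.2 • L (η : V (j+1)))) := by
        ext p
        by_cases hp : 0 < p.2 <;> simp [G, hp, indicator]
      rw [this]
      exact Measurable.indicator (by fun_prop) (MeasurableSet.univ.prod measurableSet_Ioi)
    have e3 : ∫⁻ t : ℝ, ∫⁻ r in Ioi (0:ℝ), ENNReal.ofReal (r ^ j) * H (t • k + r • L (η : V (j+1)))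
      = ∫⁻ p, G p := by
      rw [Measure.volume_eq_prod, lintegral_prod _ (by fun_prop)]
      refine lintegral_congr fun t => ?_
      rw [← lintegral_indicator measurableSet_Ioi]
    rw [e3, ← lintegral_comp_polarCoord_symm]
    have htar : polarCoord.target = Ioi (0:ℝ) ×ˢ Ioo (-π) π := rfl
    rw [htar, Measure.volume_eq_prod, ← Measure.prod_restrict, lintegral_prod _ (by
      refine Measurable.aemeasurable ?_
      simp only [polarCoord_symm_apply]
      fun_prop)]
    rw [← lintegral_const_mul _ (by fun_prop)]
    refine setLIntegral_congr_fun measurableSet_Ioi fun r (hr : 0 < r) => ?_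
    simp only []
    rw [← lintegral_mul_const _ (by fun_prop)]
    rw [← lintegral_indicator measurableSet_Ioo, ← lintegral_indicator measurableSet_Ioo]
    refine lintegral_congr fun θ => ?_
    by_cases h1 : θ ∈ Ioo 0 π
    · have h2 : θ ∈ Ioo (-π) π := ⟨by linarith [h1.1, pi_pos], h1.2⟩
      have hs : 0 < sin θ := sin_pos_of_pos_of_lt_pi h1.1 h1.2
      have hn : ‖cos θ • k + sin θ • L (η : V (j+1))‖ = 1 := by
        have : ‖cos θ • k + sin θ • L (η : V (j+1))‖ ^ 2 = 1 := by
          rw [norm_add_sq_real, norm_smul, norm_smul, inner_smul_left, inner_smul_right, hL,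
            L.norm_map, hk, hη]
          simp
        nlinarith [norm_nonneg (cos θ • k + sin θ • L (η : V (j+1)))]
      have hn2 : (r * cos θ) • k + (r * sin θ) • L (η : V (j+1)) =
        r • (cos θ • k + sin θ • L (η : V (j+1))) := by
        rw [smul_add, smul_smul, smul_smul]
      rw [indicator_of_mem h1, indicator_of_mem h2]
      simp only [polarCoord_symm_apply, G, indicator, mem_Ioi, mul_pos hr hs, if_true, H]
      rw [hn2, norm_smul, hn, norm_eq_abs, abs_of_pos hr, mul_one, smul_smul,
        inv_mul_cancel₀ hr.ne', one_smul, smul_eq_mul, mul_pow, ENNReal.ofReal_mul (by positivity),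
        pow_succ, ENNReal.ofReal_mul (by positivity)]
      ring
    · rw [indicator_of_notMem h1]
      by_cases h2 : θ ∈ Ioo (-π) π
      · rw [indicator_of_mem h2]
        have hs : ¬ (0 < sin θ) := by
          have : θ ≤ 0 := by
            by_contra h3
            exact h1 ⟨lt_of_not_ge h3, h2.2⟩
          exact not_lt.2 (sin_nonpos_of_nonpos_of_neg_pi_le this h2.1.le)
        have hs2 : ¬ (0 < r * sin θ) := fun h => hs (by
          rcases (mul_pos_iff.1 h) with h | h
          · exact h.2
          · linarith [h.1])
        simp [polarCoord_symm_apply, G, indicator, hs2]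
      · rw [indicator_of_notMem h2]
  rw [e1] at e2
  exact (ENNReal.mul_left_inj hc0 hct).1 e2

lemma lintegral_real_mul_left (a : ℝ) (ha : a ≠ 0) (f : ℝ → ℝ≥0∞) (hf : Measurable f) :
    ∫⁻ x, f (a * x) = ENNReal.ofReal |a⁻¹| * ∫⁻ x, f x := by
  have := Real.map_volume_mul_left ha
  rw [← lintegral_map hf (measurable_const_mul a), this, lintegral_smul_measure, smul_eq_mul]

lemma lintegral_V_smul {n : ℕ} (a : ℝ) (ha : a ≠ 0) (f : V n → ℝ≥0∞) (hf : Measurable f) :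
    ∫⁻ x, f (a • x) = ENNReal.ofReal |(a ^ n)⁻¹| * ∫⁻ x, f x := by
  have := Measure.map_addHaar_smul (volume : Measure (V n)) ha
  rw [← lintegral_map hf (measurable_const_smul a), this, lintegral_smul_measure, smul_eq_mul]
  simp

lemma angular_lower (j : ℕ) (s cb : ℝ) (hs0 : 0 < s) (hcb : 0 < cb) :
    ∃ c : ℝ, 0 < c ∧ ∀ b : ℝ → ℝ, KernelAssumptions (j+2) s cb b → ∀ k : V (j+2), ‖k‖ = 1 →
      ∀ h : V (j+2) → ℝ≥0∞, Measurable h →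
      ENNReal.ofReal c * ∫⁻ ω : sphere (0 : V (j+2)) 1,
        (if 0 ≤ ⟪k, (ω : V (j+2))⟫ ∧ 1/2 ≤ ⟪k, (ω : V (j+2))⟫ ^ 2 then
          ENNReal.ofReal ((1 - ⟪k, (ω : V (j+2))⟫ ^ 2) ^ (-(((j:ℝ) + 1 + 2 * s) / 2))) else 0) *
          h ((2 * ⟪k, (ω : V (j+2))⟫) • (ω : V (j+2)) - k) ∂(sphMeas (j+2)) ≤
      ∫⁻ σ : sphere (0 : V (j+2)) 1, ENNReal.ofReal (b ⟪k, (σ : V (j+2))⟫) * h σ ∂(sphMeas (j+2)) := by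
  refine ⟨2 * cb * 2 ^ (-(1 + 2 * s)) * (2 / π) ^ (1 + 2 * s), by positivity, ?_⟩
  intro b hb k hk h hh
  set c := 2 * cb * 2 ^ (-(1 + 2 * s)) * (2 / π) ^ (1 + 2 * s) with hc
  have hcpos : 0 < c := by positivity
  obtain ⟨hbm, hb0, -, hb2⟩ := hb
  obtain ⟨L, hL, hsc⟩ := sphere_coords k hk
  have hmif : Measurable (fun ω : V (j+2) => if 0 ≤ ⟪k, ω⟫ ∧ 1/2 ≤ ⟪k, ω⟫ ^ 2 then
          ENNReal.ofReal ((1 - ⟪k, ω⟫ ^ 2) ^ (-(((j:ℝ) + 1 + 2 * s) / 2))) else 0) := by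
    refine Measurable.ite ?_ (by fun_prop) measurable_const
    have m1 : MeasurableSet {ω : V (j+2) | 0 ≤ ⟪k, ω⟫} :=
      measurableSet_le measurable_const (by fun_prop)
    have m2 : MeasurableSet {ω : V (j+2) | 1/2 ≤ ⟪k, ω⟫ ^ 2} :=
      measurableSet_le measurable_const (by fun_prop)
    exact m1.inter m2
  rw [hsc (fun ω => (if 0 ≤ ⟪k, ω⟫ ∧ 1/2 ≤ ⟪k, ω⟫ ^ 2 then
          ENNReal.ofReal ((1 - ⟪k, ω⟫ ^ 2) ^ (-(((j:ℝ) + 1 + 2 * s) / 2))) else 0) *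
          h ((2 * ⟪k, ω⟫) • ω - k)) (by fun_prop),
    hsc (fun σ => ENNReal.ofReal (b ⟪k, σ⟫) * h σ) (by fun_prop)]
  rw [← lintegral_const_mul]
  swap
  · refine Measurable.lintegral_prod_right' (f := fun p : (sphere (0 : V (j+1)) 1) × ℝ =>
      ENNReal.ofReal (sin p.2 ^ j) * ((fun ω => (if 0 ≤ ⟪k, ω⟫ ∧ 1/2 ≤ ⟪k, ω⟫ ^ 2 then
          ENNReal.ofReal ((1 - ⟪k, ω⟫ ^ 2) ^ (-(((j:ℝ) + 1 + 2 * s) / 2))) else 0) *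
          h ((2 * ⟪k, ω⟫) • ω - k)) (cos p.2 • k + sin p.2 • L (p.1 : V (j+1))))) ?_
    have m3 : Measurable (fun p : (sphere (0 : V (j+1)) 1) × ℝ =>
      cos p.2 • k + sin p.2 • L (p.1 : V (j+1))) := by fun_prop
    have m4 : Measurable (fun ω => (if 0 ≤ ⟪k, ω⟫ ∧ 1/2 ≤ ⟪k, ω⟫ ^ 2 then
          ENNReal.ofReal ((1 - ⟪k, ω⟫ ^ 2) ^ (-(((j:ℝ) + 1 + 2 * s) / 2))) else 0) *
          h ((2 * ⟪k, ω⟫) • ω - k)) := by fun_prop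
    exact Measurable.mul (by fun_prop) (m4.comp m3)
  refine lintegral_mono fun η => ?_
  have hkk : ⟪k, k⟫ = 1 := by rw [real_inner_self_eq_norm_sq, hk]; norm_num
  have hin : ∀ θ : ℝ, ⟪k, cos θ • k + sin θ • L (η : V (j+1))⟫ = cos θ := by
    intro θ
    rw [inner_add_right, inner_smul_right, inner_smul_right, hL, hkk]; ring
  have hdb : ∀ θ : ℝ, (2 * cos θ) • (cos θ • k + sin θ • L (η : V (j+1))) - k
      = cos (2 * θ) • k + sin (2 * θ) • L (η : V (j+1)) := by
    intro θ
    rw [cos_two_mul, sin_two_mul]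
    module
  simp only [hin, hdb]
  rw [← lintegral_const_mul']
  swap
  · exact ENNReal.ofReal_ne_top
  rw [← lintegral_indicator measurableSet_Ioo, ← lintegral_indicator measurableSet_Ioo]
  set Bq : ℝ → ℝ≥0∞ := (Ioo 0 π).indicator (fun θ => ENNReal.ofReal (sin θ ^ j) *
    (ENNReal.ofReal (b (cos θ)) * h (cos θ • k + sin θ • L (η : V (j+1))))) with hBq
  have hBm : Measurable Bq := Measurable.indicator (by fun_prop) measurableSet_Ioo
  have e2 : ∫⁻ θ, Bq θ = ENNReal.ofReal 2 * ∫⁻ φ, Bq (2 * φ) := by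
    rw [lintegral_real_mul_left 2 two_ne_zero Bq hBm, ← mul_assoc, ← ENNReal.ofReal_mul (by norm_num)]
    norm_num
  rw [e2, ← lintegral_const_mul _ (by fun_prop)]
  refine lintegral_mono fun φ => ?_
  by_cases hφ : φ ∈ Ioo 0 π
  swap
  · rw [indicator_of_notMem hφ]; exact zero_le
  rw [indicator_of_mem hφ]
  by_cases hcos : 0 ≤ cos φ ∧ 1/2 ≤ cos φ ^ 2
  swap
  · simp only [hcos, if_false]; simp
  have hφ4 : 2 * φ ≤ π / 2 := by
    by_contra hlt
    push Not at hlt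
    have h1 : cos (2 * φ) < 0 := by
      refine cos_neg_of_pi_div_two_lt_of_lt hlt ?_
      have : φ ≤ π / 2 := by
        by_contra h3
        push Not at h3
        have := cos_neg_of_pi_div_two_lt_of_lt h3 (by linarith [hφ.2, pi_pos])
        linarith [hcos.1]
      linarith [pi_pos]
    rw [cos_two_mul] at h1
    linarith [hcos.2]
  have hmem : 2 * φ ∈ Ioo 0 π := ⟨by linarith [hφ.1], by linarith [pi_pos]⟩
  rw [if_pos hcos, hBq, indicator_of_mem hmem]
  simp only [← mul_assoc]
  refine mul_le_mul' ?_ le_rfl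
  have hsin : 0 < sin φ := sin_pos_of_pos_of_lt_pi hφ.1 hφ.2
  have hsin2 : 0 < sin (2 * φ) := sin_pos_of_pos_of_lt_pi hmem.1 hmem.2
  rw [← ENNReal.ofReal_mul hcpos.le, ← ENNReal.ofReal_mul (by positivity),
    ← ENNReal.ofReal_mul (by norm_num), ← ENNReal.ofReal_mul (by positivity)]
  apply ENNReal.ofReal_le_ofReal
  have hb3 := (hb2 (2 * φ) ⟨hmem.1, hφ4⟩).1
  have hexp : (((j+2 : ℕ) : ℝ) - 2) = (j : ℝ) := by push_cast; ring
  rw [hexp, rpow_natCast] at hb3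
  have e3 : (1 - cos φ ^ 2) ^ (-(((j:ℝ) + 1 + 2 * s) / 2)) = sin φ ^ (-((j:ℝ) + 1 + 2 * s)) := by
    rw [← sin_sq, ← rpow_natCast, ← rpow_mul hsin.le]
    congr 1; push_cast; ring
  have e4 : sin φ ^ j * sin φ ^ (-((j:ℝ) + 1 + 2 * s)) = sin φ ^ (-(1 + 2 * s)) := by
    rw [← rpow_natCast, ← rpow_add hsin]; congr 1; ring
  have e5 : sin φ ^ (-(1 + 2 * s)) ≤ (2 / π * φ) ^ (-(1 + 2 * s)) := by
    refine rpow_le_rpow_of_nonpos (mul_pos (by positivity) hφ.1) ?_ (by linarith)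
    exact mul_le_sin hφ.1.le (by linarith [hφ.1])
  have e6 : c * (2 / π * φ) ^ (-(1 + 2 * s)) = 2 * (cb * (2 * φ) ^ (-(1 + 2 * s))) := by
    rw [mul_rpow (by positivity) hφ.1.le, mul_rpow (by positivity) hφ.1.le, hc,
      rpow_neg (x := 2 / π) (by positivity)]
    have : (2 / π) ^ (1 + 2 * s) ≠ 0 := by positivity
    field_simp
  calc c * sin φ ^ j * (1 - cos φ ^ 2) ^ (-(((j:ℝ) + 1 + 2 * s) / 2))
      = c * sin φ ^ (-(1 + 2 * s)) := by rw [e3, mul_assoc, e4]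
    _ ≤ c * (2 / π * φ) ^ (-(1 + 2 * s)) := by gcongr
    _ = 2 * (cb * (2 * φ) ^ (-(1 + 2 * s))) := e6
    _ ≤ 2 * (sin (2 * φ) ^ j * b (cos (2 * φ))) := by gcongr
    _ = _ := by ring

lemma two_plane {j : ℕ} (ω ω' : V (j+2)) (hω : ‖ω‖ = 1) (hω' : ‖ω'‖ = 1) (q : ℝ) (hq : 0 < q)
    (hq2 : q ^ 2 = 1 - ⟪ω, ω'⟫ ^ 2) :
    ∃ e : V (j+2), ∃ L : V j →ₗᵢ[ℝ] V (j+2), ‖e‖ = 1 ∧ ⟪ω, e⟫ = 0 ∧ ⟪ω', e⟫ = q ∧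
      (∀ z, ⟪ω, L z⟫ = 0) ∧ (∀ z, ⟪e, L z⟫ = 0) ∧ (∀ z, ⟪ω', L z⟫ = 0) ∧
      ∀ h : V (j+2) → ℝ≥0∞, Measurable h →
        ∫⁻ u, h u = ∫⁻ l : ℝ, ∫⁻ m : ℝ, ∫⁻ z : V j, ENNReal.ofReal (q⁻¹) *
          h (l • ω + ((m - ⟪ω, ω'⟫ * l) / q) • e + L z) := by
  set c := ⟪ω, ω'⟫ with hc
  have hωω : ⟪ω, ω⟫ = 1 := by rw [real_inner_self_eq_norm_sq, hω]; norm_num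
  have hωω' : ⟪ω', ω'⟫ = 1 := by rw [real_inner_self_eq_norm_sq, hω']; norm_num
  have hc' : ⟪ω', ω⟫ = c := by rw [real_inner_comm]
  obtain ⟨L1, hL1, hs1, hd1⟩ := exists_decomp ω hω
  let e : V (j+2) := q⁻¹ • (ω' - c • ω)
  have he1 : ⟪ω, e⟫ = 0 := by
    simp only [e, inner_smul_right, inner_sub_right, ← hc, hωω]; ring
  have he2 : ⟪ω', e⟫ = q := by
    simp only [e, inner_smul_right, inner_sub_right, hc', hωω']
    rw [show 1 - c * c = q ^ 2 by rw [hq2]; ring]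
    field_simp
  have hω'e : ω' = c • ω + q • e := by
    simp only [e, smul_smul, mul_inv_cancel₀ hq.ne']; module
  have hee : ⟪e, e⟫ = 1 := by
    have : ⟪e, e⟫ = q⁻¹ * (⟪ω', e⟫ - c * ⟪ω, e⟫) := by
      conv_lhs => lhs; simp only [e]
      rw [inner_smul_left, inner_sub_left, inner_smul_left]
      simp
    rw [this, he1, he2]; field_simp; ring
  have hen : ‖e‖ = 1 := by
    rw [real_inner_self_eq_norm_sq] at hee
    nlinarith [norm_nonneg e]
  obtain ⟨t0, y0, hy0⟩ := hs1 e
  have ht0 : t0 = 0 := by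
    have : ⟪ω, e⟫ = t0 := by
      rw [hy0, inner_add_right, inner_smul_right, hL1, hωω]; ring
    rw [← this, he1]
  rw [ht0, zero_smul, zero_add] at hy0
  have hy0n : ‖y0‖ = 1 := by rw [← hen, hy0, L1.norm_map]
  obtain ⟨L2, hL2, -, hd2⟩ := exists_decomp y0 hy0n
  have hL1' : ∀ z, ⟪ω, L1.comp L2 z⟫ = 0 := fun z => hL1 _
  have hL2' : ∀ z, ⟪e, L1.comp L2 z⟫ = 0 := fun z => by
    rw [hy0]
    exact (L1.inner_map_map _ _).trans (hL2 z)
  refine ⟨e, L1.comp L2, hen, he1, he2, hL1', hL2', ?_, ?_⟩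
  · intro z
    conv_lhs => rw [hω'e]
    rw [inner_add_left, inner_smul_left, inner_smul_left, hL1', hL2']; simp
  intro h hh
  rw [hd1 h hh]
  refine lintegral_congr fun l => ?_
  rw [hd2 (fun y => h (l • ω + L1 y)) (by fun_prop)]
  have hG : Measurable (fun t : ℝ => ∫⁻ z : V j, h (l • ω + t • e + L1.comp L2 z)) := by
    refine Measurable.lintegral_prod_right' (f := fun p : ℝ × V j =>
      h (l • ω + p.1 • e + L1.comp L2 p.2)) ?_
    fun_prop
  set G := (fun t : ℝ => ∫⁻ z : V j, h (l • ω + t • e + L1.comp L2 z)) with hGdef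
  have e1 : ∀ t : ℝ, ∫⁻ z : V j, h (l • ω + L1 (t • y0 + L2 z)) = G t := by
    intro t
    simp only [hGdef]
    refine lintegral_congr fun z => ?_
    rw [map_add, map_smul, ← hy0]
    exact congrArg h (add_assoc _ _ _).symm
  have e2 : ∀ m : ℝ, ∫⁻ z : V j, ENNReal.ofReal (q⁻¹) *
          h (l • ω + ((m - c * l) / q) • e + L1.comp L2 z) = ENNReal.ofReal q⁻¹ * G ((m - c * l) / q) := by
    intro m
    rw [lintegral_const_mul _ (by fun_prop)]
  simp only [e1, e2]
  rw [lintegral_const_mul _ (by fun_prop)]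
  rw [lintegral_sub_right_eq_self (fun x => G (x / q)) (c * l)]
  have e3 := lintegral_real_mul_left q⁻¹ (by positivity) G hG
  have e4 : ∀ x : ℝ, x / q = q⁻¹ * x := fun x => by ring
  simp only [e4]
  rw [e3, ← mul_assoc, ← ENNReal.ofReal_mul (by positivity)]
  rw [inv_inv, abs_of_pos hq, inv_mul_cancel₀ hq.ne']
  simp

/-- if `x, y` are comparable then so are their powers. -/
lemma rpow_comparable {x y c : ℝ} (p : ℝ) (hx : 0 < x) (hy : 0 < y) (hc : 1 ≤ c)
    (h1 : y ≤ c * x) (h2 : x ≤ c * y) : y ^ p ≤ c ^ |p| * x ^ p := by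
  have hc0 : 0 < c := by linarith
  rcases le_total 0 p with hp | hp
  · rw [abs_of_nonneg hp, ← mul_rpow hc0.le hx.le]
    exact rpow_le_rpow hy.le h1 hp
  · rw [abs_of_nonpos hp]
    have h3 : x / c ≤ y := by rw [div_le_iff₀ hc0]; linarith
    calc y ^ p ≤ (x / c) ^ p := rpow_le_rpow_of_nonpos (by positivity) h3 hp
      _ = c ^ (-p) * x ^ p := by
        rw [div_rpow hx.le hc0.le, rpow_neg hc0.le]; field_simp

lemma jap_pos {n : ℕ} (v : V n) : 0 < jap v := by unfold jap; positivity

lemma one_le_jap {n : ℕ} (v : V n) : 1 ≤ jap v := by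
  unfold jap
  rw [show (1:ℝ) = Real.sqrt 1 by simp]
  exact Real.sqrt_le_sqrt (by simp)

lemma norm_le_jap {n : ℕ} (v : V n) : ‖v‖ ≤ jap v := by
  unfold jap
  exact Real.le_sqrt_of_sq_le (by linarith)

lemma jap_le {n : ℕ} (v : V n) : jap v ≤ 1 + ‖v‖ := by
  unfold jap
  rw [Real.sqrt_le_left (by positivity)]
  nlinarith [norm_nonneg v]

@[fun_prop]
lemma measurable_jap {n : ℕ} : Measurable (jap : V n → ℝ) := by
  unfold jap; fun_prop

lemma jap_le_of_near {n : ℕ} (v w : V n) (h : ‖v - w‖ ≤ 1) : jap v ≤ 3 * jap w := by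
  have := jap_le v
  have h2 := norm_le_jap w
  have h3 := one_le_jap w
  have h4 : ‖v‖ ≤ ‖w‖ + ‖v - w‖ := by
    have := norm_add_le w (v - w); simpa using this
  linarith

/-- projection of `u` on the line through `vs` with direction `ω`. -/
def vpr {n : ℕ} (u vs ω : V n) : V n := vs + ⟪u - vs, ω⟫ • ω

def condK {n : ℕ} (R δ : ℝ) (u vs ω : V n) : Prop :=
  ‖vs‖ ≤ R ∧ δ ≤ 2 * ⟪u - vs, ω⟫ ∧ ‖u - vpr u vs ω‖ ≤ ⟪u - vs, ω⟫

@[fun_prop]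
lemma measurable_vpr {n : ℕ} {α : Type*} [MeasurableSpace α] {a b c : α → V n}
    (ha : Measurable a) (hb : Measurable b) (hc : Measurable c) :
    Measurable (fun x => vpr (a x) (b x) (c x)) := by
  unfold vpr; fun_prop

lemma measurableSet_condK {n : ℕ} (R δ : ℝ) {α : Type*} [MeasurableSpace α] {a b c : α → V n}
    (ha : Measurable a) (hb : Measurable b) (hc : Measurable c) :
    MeasurableSet {x | condK R δ (a x) (b x) (c x)} := by
  have m1 : MeasurableSet {x | ‖b x‖ ≤ R} := measurableSet_le (by fun_prop) (by fun_prop)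
  have m2 : MeasurableSet {x | δ ≤ 2 * ⟪a x - b x, c x⟫} :=
    measurableSet_le (by fun_prop) (by fun_prop)
  have m3 : MeasurableSet {x | ‖a x - vpr (a x) (b x) (c x)‖ ≤ ⟪a x - b x, c x⟫} :=
    measurableSet_le (by fun_prop) (by fun_prop)
  exact m1.inter (m2.inter m3)

lemma vpr_pyth {n : ℕ} (u vs ω : V n) (hω : ‖ω‖ = 1) :
    ‖u - vpr u vs ω‖ ^ 2 = ‖u - vs‖ ^ 2 - ⟪u - vs, ω⟫ ^ 2 := by
  have : u - vpr u vs ω = (u - vs) - ⟪u - vs, ω⟫ • ω := by unfold vpr; abel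
  rw [this, norm_sub_sq_real, inner_smul_right, norm_smul, hω]
  simp only [mul_one, norm_eq_abs, sq_abs]
  ring

lemma jap_le_of_condK {n : ℕ} {R δ : ℝ} (hδ : 0 < δ) {u vs ω : V n} (hω : ‖ω‖ = 1)
    (h : condK R δ u vs ω) : δ / 2 ≤ ‖u - vs‖ ∧ jap u ≤ (2 * (1 + R) / δ + 1) * ‖u - vs‖ ∧
      ‖u - vs‖ ≤ (2 * (1 + R) / δ + 1 + R) * jap u := by
  obtain ⟨h1, h2, h3⟩ := h
  have hin : ⟪u - vs, ω⟫ ≤ ‖u - vs‖ := by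
    have := real_inner_le_norm (u - vs) ω; rwa [hω, mul_one] at this
  have hd : δ / 2 ≤ ‖u - vs‖ := by linarith
  have hR : 0 ≤ R := (norm_nonneg _).trans h1
  refine ⟨hd, ?_, ?_⟩
  · have h5 := jap_le u
    have h4 : ‖u‖ ≤ ‖vs‖ + ‖u - vs‖ := by
      have := norm_add_le vs (u - vs); simpa using this
    have : (1 + R) ≤ 2 * (1 + R) / δ * ‖u - vs‖ := by
      calc (1 + R) = 2 * (1 + R) / δ * (δ / 2) := by field_simp
        _ ≤ _ := by gcongr
    nlinarith
  · have h4 : ‖u - vs‖ ≤ ‖u‖ + ‖vs‖ := norm_sub_le _ _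
    have h5 := norm_le_jap u
    have h6 := one_le_jap u
    have : 0 ≤ 2 * (1 + R) / δ * jap u := mul_nonneg (by positivity) (jap_pos u).le
    nlinarith

open Classical in
lemma omega_integral (j : ℕ) (s R δ : ℝ) (hs0 : 0 < s) (hδ : 0 < δ) (hR : 0 < R) :
    ∃ C : ℝ, 0 < C ∧ ∀ u ws : V (j+2), ∀ r : ℝ, 0 < r →
      ∫⁻ ω : sphere (0 : V (j+2)) 1, (if condK R δ u ws ω then
        ENNReal.ofReal (jap u ^ (j+1) * (r + ‖u - vpr u ws ω‖) ^ (-(2 * ((j:ℝ) + 1) + 2 * s)))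
        else 0) ∂(sphMeas (j+2)) ≤ ENNReal.ofReal (C * r ^ (-((j:ℝ) + 1 + 2 * s))) := by
  have hfin : IsFiniteMeasure (sphMeas (j+1)) := by unfold sphMeas; infer_instance
  set A := 2 * (1 + R) / δ + 1 with hA
  have hA0 : 0 < A := by positivity
  set Sm := (sphMeas (j+1) univ).toReal with hSm
  have hm : 0 < (j:ℝ) + 1 + 2 * s := by positivity
  refine ⟨A ^ (j+1) * (π / 2) * (1 / ((j:ℝ) + 1 + 2 * s)) * (Sm + 1), by positivity, ?_⟩
  intro u ws r hr
  by_cases huw : ¬ ∃ ω : sphere (0 : V (j+2)) 1, condK R δ u ws ω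
  · push Not at huw
    simp [huw]
  push Not at huw
  obtain ⟨ω0, hω0⟩ := huw
  obtain ⟨hd, hj, -⟩ := jap_le_of_condK hδ (by simp) hω0
  set ρ := ‖u - ws‖ with hρ
  have hρ0 : 0 < ρ := by linarith
  set k : V (j+2) := ρ⁻¹ • (u - ws) with hk
  have hkn : ‖k‖ = 1 := by
    rw [hk, norm_smul, norm_inv, norm_eq_abs, abs_of_pos hρ0]; exact inv_mul_cancel₀ hρ0.ne'
  have huk : u - ws = ρ • k := by rw [hk, smul_smul, mul_inv_cancel₀ hρ0.ne', one_smul]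
  clear_value k
  obtain ⟨L, hL, hsc⟩ := sphere_coords k hkn
  have hmeas : Measurable (fun ω : V (j+2) => if condK R δ u ws ω then
        ENNReal.ofReal (jap u ^ (j+1) * (r + ‖u - vpr u ws ω‖) ^ (-(2 * ((j:ℝ) + 1) + 2 * s)))
        else 0) := by
    refine Measurable.ite (measurableSet_condK R δ measurable_const measurable_const measurable_id)
      (by fun_prop) measurable_const
  rw [hsc _ hmeas]
  have hkk : ⟪k, k⟫ = 1 := by rw [real_inner_self_eq_norm_sq, hkn]; norm_num
  have key : ∀ η : sphere (0 : V (j+1)) 1, (∫⁻ θ in Ioo 0 π, ENNReal.ofReal (sin θ ^ j) *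
      (if condK R δ u ws (cos θ • k + sin θ • L η) then
        ENNReal.ofReal (jap u ^ (j+1) * (r + ‖u - vpr u ws (cos θ • k + sin θ • L η)‖) ^
          (-(2 * ((j:ℝ) + 1) + 2 * s)))
        else 0)) ≤ ENNReal.ofReal (A ^ (j+1) * (π / 2) * (1 / ((j:ℝ) + 1 + 2 * s)) *
          r ^ (-((j:ℝ) + 1 + 2 * s))) := by
    intro η
    have hηn : ‖(η : V (j+1))‖ = 1 := by simp
    set a := 2 * ρ / π with ha
    have ha0 : 0 < a := by positivity
    set M : ℝ := (j:ℝ) + 2 + 2 * s with hM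
    let G : ℝ → ℝ≥0∞ := (Ioi r).indicator (fun x => ENNReal.ofReal (x ^ (-M)))
    have hG : Measurable G := Measurable.indicator (by fun_prop) measurableSet_Ioi
    have step1 : (∫⁻ θ in Ioo 0 π, ENNReal.ofReal (sin θ ^ j) *
      (if condK R δ u ws (cos θ • k + sin θ • L η) then
        ENNReal.ofReal (jap u ^ (j+1) * (r + ‖u - vpr u ws (cos θ • k + sin θ • L η)‖) ^
          (-(2 * ((j:ℝ) + 1) + 2 * s)))
        else 0)) ≤ ∫⁻ θ : ℝ, ENNReal.ofReal (A ^ (j+1) * ρ) * G (a * θ + r) := by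
      rw [← lintegral_indicator measurableSet_Ioo]
      refine lintegral_mono fun θ => ?_
      by_cases hθ : θ ∈ Ioo 0 π
      swap
      · rw [indicator_of_notMem hθ]; exact zero_le
      rw [indicator_of_mem hθ]
      by_cases hco : condK R δ u ws (cos θ • k + sin θ • L η)
      swap
      · rw [if_neg hco, mul_zero]; exact zero_le
      rw [if_pos hco]
      have hsin : 0 < sin θ := sin_pos_of_pos_of_lt_pi hθ.1 hθ.2
      have hn : ‖cos θ • k + sin θ • L (η : V (j+1))‖ = 1 := by
        have : ‖cos θ • k + sin θ • L (η : V (j+1))‖ ^ 2 = 1 := by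
          rw [norm_add_sq_real, norm_smul, norm_smul, inner_smul_left, inner_smul_right, hL,
            L.norm_map, hkn, hηn]
          simp
        nlinarith [norm_nonneg (cos θ • k + sin θ • L (η : V (j+1)))]
      have hin : ⟪u - ws, cos θ • k + sin θ • L (η : V (j+1))⟫ = ρ * cos θ := by
        rw [huk, inner_add_right, inner_smul_left, inner_smul_left, inner_smul_right,
          inner_smul_right, hL, hkk]; simp
      have hnorm : ‖u - vpr u ws (cos θ • k + sin θ • L (η : V (j+1)))‖ = ρ * sin θ := by
        have h1 := vpr_pyth u ws _ hn
        rw [hin, ← hρ] at h1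
        have h2 : ‖u - vpr u ws (cos θ • k + sin θ • L (η : V (j+1)))‖ ^ 2 = (ρ * sin θ) ^ 2 := by
          rw [h1]; nlinarith [sin_sq_add_cos_sq θ]
        exact (pow_left_inj₀ (norm_nonneg _) (by positivity) two_ne_zero).1 h2
      have hcos : 0 < cos θ := by
        have := hco.2.1
        rw [hin] at this
        by_contra hneg
        push Not at hneg
        nlinarith
      have hθ2 : θ ≤ π / 2 := by
        by_contra h3
        push Not at h3
        have := cos_neg_of_pi_div_two_lt_of_lt h3 (by linarith [hθ.2, pi_pos])
        linarith
      have hjs : 2 / π * θ ≤ sin θ := mul_le_sin hθ.1.le hθ2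
      have hx : r < a * θ + r := by have := mul_pos ha0 hθ.1; linarith
      rw [show G (a * θ + r) = ENNReal.ofReal ((a * θ + r) ^ (-M)) from indicator_of_mem hx _,
        hnorm, ← ENNReal.ofReal_mul (by positivity), ← ENNReal.ofReal_mul (by positivity)]
      apply ENNReal.ofReal_le_ofReal
      have hrs : 0 < r + ρ * sin θ := by positivity
      calc sin θ ^ j * (jap u ^ (j+1) * (r + ρ * sin θ) ^ (-(2 * ((j:ℝ) + 1) + 2 * s)))
          ≤ sin θ ^ j * ((A * ρ) ^ (j+1) * (r + ρ * sin θ) ^ (-(2 * ((j:ℝ) + 1) + 2 * s))) := by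
            have := (jap_pos u).le
            gcongr
        _ = A ^ (j+1) * ρ * ((ρ * sin θ) ^ j * (r + ρ * sin θ) ^ (-(2 * ((j:ℝ) + 1) + 2 * s))) := by
            rw [mul_pow, mul_pow]; ring
        _ ≤ A ^ (j+1) * ρ * ((r + ρ * sin θ) ^ j * (r + ρ * sin θ) ^ (-(2 * ((j:ℝ) + 1) + 2 * s))) := by
            gcongr; linarith
        _ = A ^ (j+1) * ρ * (r + ρ * sin θ) ^ (-M) := by
            rw [← rpow_natCast (r + ρ * sin θ) j, ← rpow_add hrs]
            congr 2; rw [hM]; ring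
        _ ≤ A ^ (j+1) * ρ * (a * θ + r) ^ (-M) := by
            refine mul_le_mul_of_nonneg_left ?_ (by positivity)
            refine rpow_le_rpow_of_nonpos (by linarith) ?_ (by rw [hM]; linarith)
            have : a * θ ≤ ρ * sin θ := by
              calc a * θ = ρ * (2 / π * θ) := by rw [ha]; ring
                _ ≤ _ := by gcongr
            linarith
    refine step1.trans ?_
    rw [lintegral_const_mul _ (by fun_prop), lintegral_real_mul_left a ha0.ne' (fun x => G (x + r)) (by fun_prop),
      lintegral_add_right_eq_self G r, lintegral_indicator measurableSet_Ioi,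
      ← ofReal_integral_eq_lintegral_ofReal, integral_Ioi_rpow_of_lt (by rw [hM]; linarith) hr]
    · rw [← ENNReal.ofReal_mul (by positivity), ← ENNReal.ofReal_mul (by positivity)]
      apply ENNReal.ofReal_le_ofReal
      apply le_of_eq
      have e1 : -M + 1 = -((j:ℝ) + 1 + 2 * s) := by rw [hM]; ring
      rw [e1, ha, abs_of_pos (by positivity)]
      field_simp
    · exact integrableOn_Ioi_rpow_of_lt (by rw [hM]; linarith) hr
    · filter_upwards [ae_restrict_mem measurableSet_Ioi] with x hx
      have : 0 < x := hr.trans hx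
      positivity
  calc _ ≤ ∫⁻ η : sphere (0 : V (j+1)) 1, ENNReal.ofReal (A ^ (j+1) * (π / 2) *
      (1 / ((j:ℝ) + 1 + 2 * s)) * r ^ (-((j:ℝ) + 1 + 2 * s))) ∂(sphMeas (j+1)) := lintegral_mono key
    _ = ENNReal.ofReal (A ^ (j+1) * (π / 2) *
      (1 / ((j:ℝ) + 1 + 2 * s)) * r ^ (-((j:ℝ) + 1 + 2 * s))) * ENNReal.ofReal Sm := by
        rw [lintegral_const, hSm, ENNReal.ofReal_toReal (measure_ne_top _ _)]
    _ ≤ _ := by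
        rw [← ENNReal.ofReal_mul (by positivity)]
        apply ENNReal.ofReal_le_ofReal
        have : 0 ≤ A ^ (j+1) * (π / 2) * (1 / ((j:ℝ) + 1 + 2 * s)) * r ^ (-((j:ℝ) + 1 + 2 * s)) := by
          positivity
        nlinarith

lemma entropy_ge {x y : ℝ} (hx : 0 < x) (hy : 0 < y) :
    (√x - √y) ^ 2 ≤ x * Real.log (x / y) - x + y := by
  have hX := Real.sqrt_pos.2 hx
  have hY := Real.sqrt_pos.2 hy
  have h1 : Real.log (x / y) = 2 * Real.log (√x / √y) := by
    rw [Real.log_div hx.ne' hy.ne', Real.log_div hX.ne' hY.ne', Real.log_sqrt hx.le,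
      Real.log_sqrt hy.le]; ring
  have h2 : 1 - (√x / √y)⁻¹ ≤ Real.log (√x / √y) := Real.one_sub_inv_le_log_of_pos (by positivity)
  have e1 : x = √x * √x := (Real.mul_self_sqrt hx.le).symm
  have e2 : y = √y * √y := (Real.mul_self_sqrt hy.le).symm
  rw [h1]
  have h3 : x * (1 - (√x / √y)⁻¹) ≤ x * Real.log (√x / √y) := by gcongr
  have h4 : x * (1 - (√x / √y)⁻¹) = x - √x * √y := by
    rw [inv_div]; field_simp; linear_combination (-√y) * e1
  nlinarith

open Classical in
/-- lower kernel. -/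
def Kk {n : ℕ} (a m R δ : ℝ) (u vs ω : V n) : ℝ≥0∞ :=
  if condK R δ u vs ω then ENNReal.ofReal (jap u ^ a * ‖u - vpr u vs ω‖ ^ (-m)) else 0

@[fun_prop]
lemma measurable_Kk {n : ℕ} (a m R δ : ℝ) {α : Type*} [MeasurableSpace α] {x y z : α → V n}
    (hx : Measurable x) (hy : Measurable y) (hz : Measurable z) :
    Measurable (fun t => Kk a m R δ (x t) (y t) (z t)) := by
  unfold Kk
  exact Measurable.ite (measurableSet_condK R δ hx hy hz) (by fun_prop) measurable_const

lemma Kk_le (j : ℕ) (s γ R δ : ℝ) (hδ : 0 < δ) (hR : 0 < R) :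
    ∃ C : ℝ, 0 < C ∧ ∀ u vs ω : V (j+2), ‖ω‖ = 1 → u ≠ vs →
      Kk (γ + ((j:ℝ)+1+2*s)) ((j:ℝ)+1+2*s) R δ u vs ω ≤
      ENNReal.ofReal (C * ‖u - vs‖ ^ γ) *
      (if 0 ≤ ⟪‖u - vs‖⁻¹ • (u - vs), ω⟫ ∧ 1/2 ≤ ⟪‖u - vs‖⁻¹ • (u - vs), ω⟫^2 then
        ENNReal.ofReal ((1-⟪‖u - vs‖⁻¹ • (u - vs), ω⟫^2)^(-(((j:ℝ)+1+2*s)/2))) else 0) := by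
  set m : ℝ := (j:ℝ)+1+2*s with hm
  set c : ℝ := 2 * (1 + R) / δ + 1 + R with hc
  have hc1 : 1 ≤ c := by rw [hc]; have : 0 < 2 * (1+R)/δ := by positivity
                         linarith
  refine ⟨c ^ |γ + m|, by positivity, ?_⟩
  intro u vs ω hω hne
  unfold Kk
  split_ifs with h1 h2
  · have hρ : 0 < ‖u - vs‖ := norm_pos_iff.2 (sub_ne_zero.2 hne)
    obtain ⟨hd, ha, hb⟩ := jap_le_of_condK hδ hω h1
    rw [← ENNReal.ofReal_mul (by positivity)]
    apply ENNReal.ofReal_le_ofReal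
    have hp := vpr_pyth u vs ω hω
    have e1 : (1-⟪‖u - vs‖⁻¹ • (u - vs), ω⟫^2) = (‖u - vpr u vs ω‖ / ‖u - vs‖)^2 := by
      rw [div_pow, hp, real_inner_smul_left]; field_simp
    rw [e1, ← rpow_natCast, ← rpow_mul (by positivity)]
    have e2 : ((2:ℕ):ℝ) * (-(m/2)) = -m := by push_cast; ring
    rw [e2, div_rpow (norm_nonneg _) hρ.le]
    have e3 : ‖u - vs‖ ^ (γ + m) = ‖u - vs‖ ^ γ / ‖u - vs‖ ^ (-m) := by
      rw [← rpow_sub hρ]; congr 1; ring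
    have h5 := rpow_comparable (γ + m) hρ (jap_pos u) hc1 (ha.trans (by gcongr; linarith)) hb
    calc jap u ^ (γ + m) * ‖u - vpr u vs ω‖ ^ (-m)
        ≤ (c ^ |γ+m| * ‖u - vs‖ ^ (γ + m)) * ‖u - vpr u vs ω‖ ^ (-m) := by gcongr
      _ = _ := by rw [e3]; ring
  · exfalso
    apply h2
    obtain ⟨k1, k2, k3⟩ := h1
    have hρ : 0 < ‖u - vs‖ := norm_pos_iff.2 (sub_ne_zero.2 hne)
    have hin : 0 < ⟪u - vs, ω⟫ := by linarith
    rw [real_inner_smul_left]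
    refine ⟨by positivity, ?_⟩
    have hp := vpr_pyth u vs ω hω
    rw [mul_pow, inv_pow, ← div_eq_inv_mul, le_div_iff₀ (by positivity)]
    have : ‖u - vpr u vs ω‖^2 ≤ ⟪u - vs, ω⟫^2 := by gcongr
    linarith
  · exact zero_le
  · exact zero_le

lemma vprime_refl {n : ℕ} (u vs ω : V n) (hne : u ≠ vs) :
    vprime u vs ((2*⟪‖u - vs‖⁻¹ • (u - vs), ω⟫)•ω - ‖u - vs‖⁻¹ • (u - vs)) = vpr u vs ω := by
  have hρ : ‖u - vs‖ ≠ 0 := (norm_pos_iff.2 (sub_ne_zero.2 hne)).ne'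
  unfold vprime vpr
  rw [smul_sub, smul_smul, smul_smul, real_inner_smul_left]
  have e1 : ‖u - vs‖ / 2 * (2 * (‖u - vs‖⁻¹ * ⟪u - vs, ω⟫)) = ⟪u - vs, ω⟫ := by field_simp
  have e2 : ‖u - vs‖ / 2 * ‖u - vs‖⁻¹ = 2⁻¹ := by field_simp
  rw [e1, e2]
  module

/-- lower bound on the entropy production. -/
lemma EntS_lower (j : ℕ) (s γ CΦ cb R δ : ℝ) (hs0 : 0 < s) (hCΦ : 0 < CΦ) (hcb : 0 < cb)
    (hδ : 0 < δ) (hR : 0 < R) :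
    ∃ c : ℝ, 0 < c ∧ ∀ b : ℝ → ℝ, KernelAssumptions (j+2) s cb b →
      ∀ g : V (j+2) → ℝ, Measurable g → (∀ v, 0 ≤ g v) →
      ∀ f : V (j+2) → ℝ, Measurable f → (∀ v, 0 < f v) →
      ENNReal.ofReal c * ∫⁻ u : V (j+2), ∫⁻ vs : V (j+2), ENNReal.ofReal (g vs) *
        ∫⁻ ω : sphere (0 : V (j+2)) 1,
          Kk (γ + ((j:ℝ)+1+2*s)) ((j:ℝ)+1+2*s) R δ u vs ω *
            ENNReal.ofReal ((√(f u) - √(f (vpr u vs ω))) ^ 2) ∂(sphMeas (j+2))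
      ≤ EntS CΦ γ b g f := by
  obtain ⟨c1, hc1, H1⟩ := angular_lower j s cb hs0 hcb
  obtain ⟨C2, hC2, H2⟩ := Kk_le j s γ R δ hδ hR
  refine ⟨c1 * C2⁻¹ * CΦ, by positivity, ?_⟩
  intro b hb g hg hg0 f hf hf0
  unfold EntS
  rw [← lintegral_const_mul' _ _ ENNReal.ofReal_ne_top]
  apply lintegral_mono; intro u
  beta_reduce
  rw [← lintegral_const_mul' _ _ ENNReal.ofReal_ne_top]
  apply lintegral_mono_ae
  have hae : ∀ᵐ vs : V (j+2), vs ≠ u := by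
    have := (measure_eq_zero_iff_ae_notMem (μ := volume)).1 (measure_singleton u)
    filter_upwards [this] with x hx
    simpa using hx
  filter_upwards [hae] with vs hvs
  have hne : u ≠ vs := hvs.symm
  have hρ : 0 < ‖u - vs‖ := norm_pos_iff.2 (sub_ne_zero.2 hne)
  set k : V (j+2) := ‖u - vs‖⁻¹ • (u - vs) with hk
  have hkn : ‖k‖ = 1 := by rw [hk, norm_smul, norm_inv, norm_norm]; exact inv_mul_cancel₀ hρ.ne'
  let h : V (j+2) → ℝ≥0∞ := fun σ => ENNReal.ofReal (CΦ * ‖u - vs‖ ^ γ * g vs) *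
    ENNReal.ofReal ((√(f u) - √(f (vprime u vs σ))) ^ 2)
  have hh : Measurable h := by
    have : Measurable (fun σ => vprime u vs σ) := by unfold vprime; fun_prop
    fun_prop
  have key := H1 b hb k hkn h hh
  calc _ ≤ ENNReal.ofReal c1 * ∫⁻ω : sphere (0 : V (j+2)) 1, (if 0 ≤ ⟪k,(ω:V (j+2))⟫ ∧ 1/2 ≤ ⟪k,(ω : V (j+2))⟫^2 then ENNReal.ofReal ((1-⟪k,(ω : V (j+2))⟫^2)^(-(((j:ℝ)+1+2*s)/2))) else 0) * h ((2*⟪k,(ω : V (j+2))⟫)•(ω : V (j+2)) - k) ∂(sphMeas (j+2)) := by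
        rw [show c1 * C2⁻¹ * CΦ = c1 * (C2⁻¹ * CΦ) by ring, ENNReal.ofReal_mul hc1.le, mul_assoc]
        gcongr
        rw [← mul_assoc, ← lintegral_const_mul' _ _ (ENNReal.mul_ne_top ENNReal.ofReal_ne_top ENNReal.ofReal_ne_top)]
        apply lintegral_mono
        intro ω
        have hω : ‖(ω : V (j+2))‖ = 1 := by simp
        have h3 := H2 u vs ω hω hne
        simp only [h]
        rw [hk, vprime_refl u vs ω hne, ← hk, ← mul_assoc, ← mul_assoc]
        refine mul_le_mul' ?_ le_rfl
        rw [← hk] at h3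
        refine (mul_le_mul' le_rfl h3).trans ?_
        rw [← mul_assoc, mul_comm (ite _ _ _)]
        refine mul_le_mul' ?_ le_rfl
        rw [← ENNReal.ofReal_mul (by positivity), ← ENNReal.ofReal_mul (mul_nonneg (by positivity) (hg0 vs))]
        apply le_of_eq; congr 1; field_simp
    _ ≤ _ := key
    _ ≤ _ := by
        apply lintegral_mono
        intro σ
        simp only [h]
        have hb0 := hb.2.1 ⟪k, (σ : V (j+2))⟫
        rw [← mul_assoc, ← ENNReal.ofReal_mul hb0, ← ENNReal.ofReal_mul (mul_nonneg hb0 (mul_nonneg (by positivity) (hg0 vs)))]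
        apply ENNReal.ofReal_le_ofReal
        unfold Bker
        rw [← hk]
        have h0 : 0 ≤ CΦ * ‖u - vs‖ ^ γ * b ⟪k, (σ : V (j+2))⟫ * g vs :=
          mul_nonneg (mul_nonneg (by positivity) hb0) (hg0 vs)
        have := mul_le_mul_of_nonneg_left (entropy_ge (hf0 u) (hf0 (vprime u vs σ))) h0
        refine le_trans (le_of_eq ?_) this
        ring

def goodP {n : ℕ} (R δ : ℝ) (v vs ws : V n) : Prop :=
  ‖vs‖ ≤ R ∧ ‖ws‖ ≤ R ∧ δ < ‖v - vs‖ ∧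
    δ ^ 2 * ‖v - vs‖ ^ 2 < ‖v - vs‖ ^ 2 * ‖ws - v‖ ^ 2 - ⟪v - vs, ws - v⟫ ^ 2

lemma measurableSet_goodP {n : ℕ} (R δ : ℝ) {α : Type*} [MeasurableSpace α] {a b c : α → V n}
    (ha : Measurable a) (hb : Measurable b) (hc : Measurable c) :
    MeasurableSet {x | goodP R δ (a x) (b x) (c x)} := by
  have m1 : MeasurableSet {x | ‖b x‖ ≤ R} := measurableSet_le (by fun_prop) (by fun_prop)
  have m2 : MeasurableSet {x | ‖c x‖ ≤ R} := measurableSet_le (by fun_prop) (by fun_prop)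
  have m3 : MeasurableSet {x | δ < ‖a x - b x‖} := measurableSet_lt (by fun_prop) (by fun_prop)
  have m4 : MeasurableSet {x | δ ^ 2 * ‖a x - b x‖ ^ 2 <
    ‖a x - b x‖ ^ 2 * ‖c x - a x‖ ^ 2 - ⟪a x - b x, c x - a x⟫ ^ 2} :=
      measurableSet_lt (by fun_prop) (by fun_prop)
  exact m1.inter (m2.inter (m3.inter m4))

open Classical in
def goodI {n : ℕ} (R δ : ℝ) (v vs ws : V n) : ℝ≥0∞ := if goodP R δ v vs ws then 1 else 0

@[fun_prop]
lemma measurable_goodI {n : ℕ} (R δ : ℝ) {α : Type*} [MeasurableSpace α] {a b c : α → V n}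
    (ha : Measurable a) (hb : Measurable b) (hc : Measurable c) :
    Measurable (fun x => goodI R δ (a x) (b x) (c x)) := by
  unfold goodI
  exact Measurable.ite (measurableSet_goodP R δ ha hb hc) measurable_const measurable_const

lemma dist_of_notMem_tube {n : ℕ} {δ : ℝ} {p u x : V n}
    (h : ¬ Metric.infDist x {y | ∃ t : ℝ, y = p + t • u} ≤ δ) (t : ℝ) :
    δ < ‖x - (p + t • u)‖ := by
  have : Metric.infDist x {y | ∃ t : ℝ, y = p + t • u} ≤ dist x (p + t • u) :=
    Metric.infDist_le_dist_of_mem ⟨t, rfl⟩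
  rw [dist_eq_norm] at this
  push Not at h
  linarith

lemma good_mass {n : ℕ} (hn : 2 ≤ n) {R δ Cg : ℝ} (hδ : 0 < δ) {g : V n → ℝ}
    (hg : Measurable g) (hL : AssumptionL R δ Cg g) (v : V n) :
    ENNReal.ofReal Cg ^ 2 ≤ ∫⁻ vs : V n, ∫⁻ ws : V n,
      ENNReal.ofReal (g vs) * (ENNReal.ofReal (g ws) * goodI R δ v vs ws) := by
  have hinner : ∀ vs : V n, ‖vs‖ ≤ R → δ < ‖v - vs‖ →
      ENNReal.ofReal Cg ≤ ∫⁻ ws : V n, ENNReal.ofReal (g ws) * goodI R δ v vs ws := by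
    intro vs h1 h2
    have hpos : 0 < ‖vs - v‖ := by rw [norm_sub_rev]; linarith
    have hne : vs - v ≠ 0 := norm_pos_iff.1 hpos
    refine (hL _ ⟨v, vs - v, hne, rfl⟩).trans ?_
    set T := {x | Metric.infDist x {y | ∃ t : ℝ, y = v + t • (vs - v)} ≤ δ} with hT
    have hTm : MeasurableSet T := measurableSet_le (by fun_prop) measurable_const
    rw [← lintegral_indicator (measurableSet_closedBall.diff hTm)]
    apply lintegral_mono
    intro ws
    by_cases hw : ws ∈ closedBall (0 : V n) R \ T
    · rw [indicator_of_mem hw]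
      have hg1 : goodP R δ v vs ws := by
        refine ⟨h1, by simpa using hw.1, h2, ?_⟩
        have h3 := dist_of_notMem_tube hw.2 (⟪ws - v, vs - v⟫ / ‖vs - v‖^2)
        have h4 : δ ^ 2 < ‖ws - (v + (⟪ws - v, vs - v⟫ / ‖vs - v‖^2) • (vs - v))‖ ^ 2 := by gcongr
        rw [← sub_sub, norm_sub_sq_real (ws - v), inner_smul_right, norm_smul, norm_eq_abs, mul_pow, sq_abs] at h4
        have h5 : ‖v - vs‖ = ‖vs - v‖ := norm_sub_rev _ _
        have h6 : ⟪v - vs, ws - v⟫ = - ⟪ws - v, vs - v⟫ := by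
          rw [real_inner_comm, ← neg_sub vs v, inner_neg_right]
        rw [h5, h6]
        have h7 : (‖ws - v‖ ^ 2 - 2 * (⟪ws - v, vs - v⟫ / ‖vs - v‖ ^ 2 * ⟪ws - v, vs - v⟫) +
          (⟪ws - v, vs - v⟫ / ‖vs - v‖ ^ 2)^2 * ‖vs - v‖ ^ 2) * ‖vs - v‖^2 =
            ‖vs - v‖ ^ 2 * ‖ws - v‖ ^ 2 - (-⟪ws - v, vs - v⟫) ^ 2 := by
          field_simp; ring
        rw [← h7]
        gcongr
      simp [goodI, hg1]
    · rw [indicator_of_notMem hw]; exact zero_le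
  have : Nontrivial (V n) := by
    have : Nonempty (Fin n) := ⟨⟨0, by omega⟩⟩
    infer_instance
  obtain ⟨e, he⟩ := exists_ne (0 : V n)
  have h0 := hL _ ⟨v, e, he, rfl⟩
  set T := {x | Metric.infDist x {y | ∃ t : ℝ, y = v + t • e} ≤ δ} with hT
  have hTm : MeasurableSet T := measurableSet_le (by fun_prop) measurable_const
  rw [← lintegral_indicator (measurableSet_closedBall.diff hTm)] at h0
  calc ENNReal.ofReal Cg ^ 2 = ENNReal.ofReal Cg * ENNReal.ofReal Cg := sq _
    _ ≤ ENNReal.ofReal Cg * _ := mul_le_mul' le_rfl h0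
    _ ≤ _ := by
      rw [← lintegral_const_mul' _ _ ENNReal.ofReal_ne_top]
      apply lintegral_mono
      intro vs
      beta_reduce
      rw [lintegral_const_mul' _ _ ENNReal.ofReal_ne_top]
      by_cases hw : vs ∈ closedBall (0 : V n) R \ T
      · rw [indicator_of_mem hw, mul_comm]
        refine mul_le_mul' le_rfl (hinner vs (by simpa using hw.1) ?_)
        have := dist_of_notMem_tube hw.2 0
        rw [zero_smul, add_zero] at this
        rwa [norm_sub_rev]
      · rw [indicator_of_notMem hw]; simp

/-- integrand of the localized seminorm. -/
def Tk {n : ℕ} (ε s γ : ℝ) (f : V n → ℝ) (v v' : V n) : ℝ≥0∞ :=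
  if anisoDist v v' ≤ ε then
    ENNReal.ofReal ((jap v * jap v') ^ ((γ + 2 * s + 1) / 2) * (f v' - f v) ^ 2 *
      anisoDist v v' ^ (-((n : ℝ) + 2 * s))) else 0

@[fun_prop]
lemma measurable_anisoDist {n : ℕ} {α : Type*} [MeasurableSpace α] {a b : α → V n}
    (ha : Measurable a) (hb : Measurable b) :
    Measurable (fun x => anisoDist (a x) (b x)) := by
  unfold anisoDist; fun_prop

@[fun_prop]
lemma measurable_Tk {n : ℕ} (ε s γ : ℝ) {f : V n → ℝ} (hf : Measurable f)
    {α : Type*} [MeasurableSpace α] {a b : α → V n}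
    (ha : Measurable a) (hb : Measurable b) :
    Measurable (fun x => Tk ε s γ f (a x) (b x)) := by
  unfold Tk
  have m : MeasurableSet {x | anisoDist (a x) (b x) ≤ ε} :=
    measurableSet_le (by fun_prop) (by fun_prop)
  exact Measurable.ite m (by fun_prop) measurable_const

lemma norm_le_aniso {n : ℕ} (v v' : V n) : ‖v - v'‖ ≤ anisoDist v v' := by
  unfold anisoDist
  exact Real.le_sqrt_of_sq_le (by nlinarith [sq_nonneg (‖v‖^2 - ‖v'‖^2)])

lemma aniso_nonneg {n : ℕ} (v v' : V n) : 0 ≤ anisoDist v v' := Real.sqrt_nonneg _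

lemma abs_le_aniso {n : ℕ} (v v' : V n) : |‖v‖^2 - ‖v'‖^2| ≤ 2 * anisoDist v v' := by
  unfold anisoDist
  have : |‖v‖^2 - ‖v'‖^2| / 2 ≤ Real.sqrt (‖v - v'‖ ^ 2 + 4⁻¹ * (‖v‖ ^ 2 - ‖v'‖ ^ 2) ^ 2) := by
    apply Real.le_sqrt_of_sq_le
    rw [div_pow, sq_abs]; nlinarith [sq_nonneg (‖v - v'‖)]
  linarith

lemma aniso_step {n : ℕ} (v x : V n) (K i : ℕ) (hK : 0 < K) (hi : i < K)
    (hd : anisoDist v (v + x) ≤ 1) :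
    anisoDist (v + ((i:ℝ)/K) • x) (v + ((i:ℝ)/K) • x + ((K:ℝ)⁻¹) • x) ≤
      4 * anisoDist v (v + x) / K := by
  have h1 := norm_le_aniso v (v + x)
  have h2 := abs_le_aniso v (v + x)
  set d := anisoDist v (v + x) with hdd
  have hd0 : 0 ≤ d := aniso_nonneg _ _
  have hK0 : (0:ℝ) < K := by exact_mod_cast hK
  have hiK : (i:ℝ) + 1 ≤ K := by exact_mod_cast hi
  have hi0 : (0:ℝ) ≤ i := by positivity
  have hx : ‖x‖ ≤ d := by simpa using h1
  unfold anisoDist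
  apply Real.sqrt_le_iff.2 ⟨by positivity, ?_⟩
  have e1 : ‖v + ((i:ℝ)/K) • x - (v + ((i:ℝ)/K) • x + ((K:ℝ)⁻¹) • x)‖ = ‖x‖ / K := by
    rw [sub_add_cancel_left, norm_neg, norm_smul, norm_inv, RCLike.norm_natCast]; field_simp
  have e2 : ‖v + ((i:ℝ)/K) • x‖^2 - ‖v + ((i:ℝ)/K) • x + ((K:ℝ)⁻¹) • x‖^2 =
    ((‖v‖^2 - ‖v+x‖^2) - ‖x‖^2 * ((2 * i + 1)/K - 1)) / K := by
    rw [add_assoc, ← add_smul, norm_add_sq_real, norm_add_sq_real, norm_add_sq_real v x, inner_smul_right,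
      inner_smul_right, norm_smul, norm_smul, mul_pow, mul_pow, norm_eq_abs, norm_eq_abs, sq_abs, sq_abs]
    field_simp
    ring
  rw [e1, e2]
  have h3 : |(‖v‖^2 - ‖v+x‖^2) - ‖x‖^2 * ((2 * i + 1)/K - 1)| ≤ 3 * d := by
    have h4 : |‖x‖^2 * ((2 * i + 1)/K - 1)| ≤ d := by
      rw [abs_mul, abs_of_nonneg (by positivity)]
      have h5 : |((2 * (i:ℝ) + 1)/K - 1)| ≤ 1 := by
        rw [abs_le]
        constructor
        · have : 0 ≤ (2 * (i:ℝ) + 1)/K := by positivity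
          linarith
        · have : (2 * (i:ℝ) + 1)/K ≤ 2 := by rw [div_le_iff₀ hK0]; linarith
          linarith
      calc ‖x‖^2 * |((2 * (i:ℝ) + 1)/K - 1)| ≤ ‖x‖^2 * 1 := by gcongr
        _ ≤ d := by nlinarith [norm_nonneg x]
    have h7 := abs_le.1 h2
    have h8 := abs_le.1 h4
    rw [abs_le]
    constructor <;> linarith [h7.1, h7.2, h8.1, h8.2]
  have h6 := sq_le_sq' (by linarith [(abs_le.1 h3).1]) (abs_le.1 h3).2
  rw [div_pow, div_pow, div_pow, ← mul_div_assoc, ← add_div]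
  gcongr
  nlinarith [norm_nonneg x]

lemma Tk_step {n : ℕ} (hn : 0 < n) (ε s γ : ℝ) (hs : 0 < s) (K : ℕ) (hK : 0 < K) (hε : 4 / (K:ℝ) ≤ ε)
    (f : V n → ℝ) (v x : V n) :
    Tk 1 s γ f v (v + x) ≤ ∑ i ∈ Finset.range K,
      ENNReal.ofReal (K * 9 ^ |(γ + 2 * s + 1) / 2| * (4/K) ^ ((n:ℝ) + 2 * s)) *
        Tk ε s γ f (v + ((i:ℝ)/K) • x) (v + ((i:ℝ)/K) • x + ((K:ℝ)⁻¹) • x) := by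
  have hK0 : (0:ℝ) < K := by exact_mod_cast hK
  by_cases hd : anisoDist v (v + x) ≤ 1
  swap
  · simp [Tk, hd]
  by_cases hx : x = 0
  · subst hx; simp [Tk]
  set p : ℕ → V n := fun i => v + ((i:ℝ)/K) • x with hp
  have hps : ∀ i : ℕ, v + ((i:ℝ)/K) • x + ((K:ℝ)⁻¹) • x = p (i+1) := by
    intro i; simp only [hp]; rw [add_assoc, ← add_smul]; congr 2; push_cast; field_simp
  set a := (γ + 2 * s + 1) / 2
  set N := (n:ℝ) + 2 * s with hN
  have hN0 : 0 < N := by positivity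
  set d := anisoDist v (v + x) with hdd
  have hxd : ‖x‖ ≤ d := by simpa using norm_le_aniso v (v + x)
  have hx0 : 0 < ‖x‖ := norm_pos_iff.2 hx
  have hd0 : 0 < d := by linarith
  have tele : (f (v + x) - f v)^2 ≤ K * ∑ i ∈ Finset.range K, (f (p (i+1)) - f (p i))^2 := by
    have h1 := Finset.sum_range_sub (fun i => f (p i)) K
    have h2 : p 0 = v := by simp [hp]
    have h3 : p K = v + x := by simp [hp, div_self hK0.ne']
    beta_reduce at h1
    rw [h2, h3] at h1
    rw [← h1]
    have := sq_sum_le_card_mul_sum_sq (s := Finset.range K) (f := fun i => f (p (i+1)) - f (p i))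
    simpa using this
  have hnear : ∀ i ≤ K, ‖v - p i‖ ≤ 1 ∧ ‖v + x - p i‖ ≤ 1 := by
    intro i hi
    have hi' : (i:ℝ)/K ≤ 1 := by rw [div_le_one hK0]; exact_mod_cast hi
    have hi0 : 0 ≤ (i:ℝ)/K := by positivity
    constructor
    · simp only [hp]; rw [sub_add_cancel_left, norm_neg, norm_smul, norm_eq_abs, abs_of_nonneg hi0]
      nlinarith
    · have : v + x - p i = (1 - (i:ℝ)/K) • x := by simp only [hp]; module
      rw [this, norm_smul, norm_eq_abs, abs_of_nonneg (by linarith)]; nlinarith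
  have term : ∀ i ∈ Finset.range K, (jap v * jap (v+x))^a * d ^ (-N) * (K * (f (p (i+1)) - f (p i))^2) ≤
     (K * 9 ^ |a| * (4/K) ^ N) * ((jap (p i) * jap (p (i+1)))^a * (f (p (i+1)) - f (p i))^2 *
      anisoDist (p i) (p (i+1)) ^ (-N)) := by
    intro i hi
    have hi : i < K := by simpa using hi
    have hst := aniso_step v x K i hK hi hd
    rw [hps i, ← hdd] at hst
    change anisoDist (p i) (p (i+1)) ≤ _ at hst
    have hpos : 0 < anisoDist (p i) (p (i+1)) := by
      have := norm_le_aniso (p i) (p (i+1))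
      have e : p i - p (i+1) = -((K:ℝ)⁻¹ • x) := by rw [← hps i]; simp only [hp]; abel
      rw [e, norm_neg, norm_smul, norm_inv, RCLike.norm_natCast] at this
      have : 0 < (K:ℝ)⁻¹ * ‖x‖ := by positivity
      linarith
    have hw : (jap v * jap (v+x))^a ≤ 9^|a| * (jap (p i) * jap (p (i+1)))^a := by
      have j1 := jap_pos v
      have j2 := jap_pos (v+x)
      have j3 := jap_pos (p i)
      have j4 := jap_pos (p (i+1))
      have k1 := jap_le_of_near _ _ (hnear i hi.le).1
      have k2 := jap_le_of_near _ _ (hnear (i+1) hi).2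
      have k3 := jap_le_of_near (p i) v (by rw [norm_sub_rev]; exact (hnear i hi.le).1)
      have k4 := jap_le_of_near (p (i+1)) (v+x) (by rw [norm_sub_rev]; exact (hnear (i+1) hi).2)
      apply rpow_comparable a (by positivity) (by positivity) (by norm_num)
      · calc _ ≤ (3 * jap (p i)) * (3 * jap (p (i+1))) := by gcongr
          _ = _ := by ring
      · calc _ ≤ (3 * jap v) * (3 * jap (v+x)) := by gcongr
          _ = _ := by ring
    have hdN : d ^ (-N) ≤ (4/K)^N * anisoDist (p i) (p (i+1)) ^ (-N) := by
      have : anisoDist (p i) (p (i+1)) / (4 / K) ≤ d := by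
        rw [div_le_iff₀ (by positivity)]; linarith [hst, show 4 * d / K = d * (4/K) by ring]
      calc d ^ (-N) ≤ (anisoDist (p i) (p (i+1)) / (4 / K)) ^ (-N) :=
            rpow_le_rpow_of_nonpos (by positivity) this (by linarith)
        _ = _ := by
            rw [div_rpow hpos.le (by positivity), rpow_neg (show (0:ℝ) ≤ 4/K by positivity)]; field_simp
    have j3 := jap_pos (p i)
    have j4 := jap_pos (p (i+1))
    calc _ ≤ (9^|a| * (jap (p i) * jap (p (i+1)))^a) * ((4/K)^N * anisoDist (p i) (p (i+1)) ^ (-N)) * (K * (f (p (i+1)) - f (p i))^2) := by gcongr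
      _ = _ := by ring
  have j1 := jap_pos v
  have j2 := jap_pos (v+x)
  unfold Tk
  rw [if_pos hd]
  calc ENNReal.ofReal ((jap v * jap (v + x)) ^ a * (f (v + x) - f v) ^ 2 * d ^ (-N))
     ≤ ENNReal.ofReal (∑ i ∈ Finset.range K, (jap v * jap (v+x))^a * d ^ (-N) * (K * (f (p (i+1)) - f (p i))^2)) := by
        apply ENNReal.ofReal_le_ofReal
        rw [← Finset.mul_sum, ← Finset.mul_sum]
        calc _ = (jap v * jap (v+x))^a * d ^ (-N) * (f (v + x) - f v) ^ 2 := by ring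
          _ ≤ _ := by gcongr
    _ = ∑ i ∈ Finset.range K, ENNReal.ofReal ((jap v * jap (v+x))^a * d ^ (-N) * (K * (f (p (i+1)) - f (p i))^2)) := by
        apply ENNReal.ofReal_sum_of_nonneg
        intro i hi; positivity
    _ ≤ _ := by
        apply Finset.sum_le_sum
        intro i hi
        refine (ENNReal.ofReal_le_ofReal (term i hi)).trans ?_
        have hi' : i < K := by simpa using hi
        have hst := aniso_step v x K i hK hi' hd
        rw [if_pos, ENNReal.ofReal_mul (by positivity), hps i]
        refine hst.trans (le_trans ?_ hε)
        rw [← hdd]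
        gcongr; linarith

lemma locality {n : ℕ} (hn : 0 < n) (ε s γ : ℝ) (hs : 0 < s) (hε : 0 < ε) :
    ∃ C : ℝ, 0 < C ∧ ∀ f : V n → ℝ, Measurable f →
      NdotSq s γ f ≤ ENNReal.ofReal C * ∫⁻ v : V n, ∫⁻ v' : V n, Tk ε s γ f v v' := by
  obtain ⟨K, hK⟩ := exists_nat_gt (4 / ε)
  have hK0 : (0:ℝ) < K := lt_trans (by positivity) hK
  have hKn : 0 < K := by exact_mod_cast hK0
  have hKε : 4 / (K:ℝ) ≤ ε := by
    rw [div_le_iff₀ hK0]; rw [div_lt_iff₀ hε] at hK; linarith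
  set C1 := (K:ℝ) * 9 ^ |(γ + 2 * s + 1) / 2| * (4/K) ^ ((n:ℝ) + 2 * s) with hC1
  have hC10 : 0 < C1 := by positivity
  refine ⟨K * (C1 * |(((K:ℝ)⁻¹)^n)⁻¹|), by positivity, ?_⟩
  intro f hf
  have e0 : NdotSq s γ f = ∫⁻ v : V n, ∫⁻ x : V n, Tk 1 s γ f v (v + x) := by
    unfold NdotSq
    apply lintegral_congr; intro v
    exact (lintegral_add_left_eq_self (μ := volume) (fun v' => Tk 1 s γ f v v') v).symm
  rw [e0]
  calc _ ≤ ∫⁻ v : V n, ∫⁻ x : V n, ∑ i ∈ Finset.range K, ENNReal.ofReal C1 *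
        Tk ε s γ f (v + ((i:ℝ)/K) • x) (v + ((i:ℝ)/K) • x + ((K:ℝ)⁻¹) • x) := by
        apply lintegral_mono; intro v; apply lintegral_mono; intro x
        exact Tk_step hn ε s γ hs K hKn hKε f v x
    _ = ∑ i ∈ Finset.range K, ENNReal.ofReal C1 * ∫⁻ v : V n, ∫⁻ x : V n, 
        Tk ε s γ f (v + ((i:ℝ)/K) • x) (v + ((i:ℝ)/K) • x + ((K:ℝ)⁻¹) • x) := by
        have : ∀ v : V n, ∫⁻ x : V n, ∑ i ∈ Finset.range K, ENNReal.ofReal C1 *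
          Tk ε s γ f (v + ((i:ℝ)/K) • x) (v + ((i:ℝ)/K) • x + ((K:ℝ)⁻¹) • x) =
          ∑ i ∈ Finset.range K, ENNReal.ofReal C1 * ∫⁻ x : V n, 
            Tk ε s γ f (v + ((i:ℝ)/K) • x) (v + ((i:ℝ)/K) • x + ((K:ℝ)⁻¹) • x) := by
          intro v
          rw [lintegral_finsetSum _ (fun i _ => by fun_prop)]
          refine Finset.sum_congr rfl fun i _ => ?_
          rw [lintegral_const_mul' _ _ ENNReal.ofReal_ne_top]
        simp_rw [this]
        rw [lintegral_finsetSum]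
        · refine Finset.sum_congr rfl fun i _ => ?_
          rw [lintegral_const_mul' _ _ ENNReal.ofReal_ne_top]
        · intro i _
          refine Measurable.const_mul ?_ _
          refine Measurable.lintegral_prod_right' (f := fun z : V n × V n =>
            Tk ε s γ f (z.1 + ((i:ℝ)/K) • z.2) (z.1 + ((i:ℝ)/K) • z.2 + ((K:ℝ)⁻¹) • z.2)) ?_
          fun_prop
    _ = ∑ i ∈ Finset.range K, ENNReal.ofReal (C1 * |(((K:ℝ)⁻¹)^n)⁻¹|) * ∫⁻ v : V n, ∫⁻ x : V n, Tk ε s γ f v x := by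
        refine Finset.sum_congr rfl fun i _ => ?_
        rw [ENNReal.ofReal_mul hC10.le, mul_assoc]
        congr 1
        rw [lintegral_lintegral_swap]
        swap
        · refine Measurable.aemeasurable ?_
          unfold Function.uncurry
          fun_prop
        have e1 : ∀ x : V n, ∫⁻ v : V n, Tk ε s γ f (v + ((i:ℝ)/K) • x) (v + ((i:ℝ)/K) • x + ((K:ℝ)⁻¹) • x) = ∫⁻ v : V n, Tk ε s γ f v (v + ((K:ℝ)⁻¹) • x) := fun x =>
          lintegral_add_right_eq_self (μ := volume) (fun v => Tk ε s γ f v (v + ((K:ℝ)⁻¹) • x)) _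
        simp_rw [e1]
        rw [lintegral_lintegral_swap]
        swap
        · refine Measurable.aemeasurable ?_
          unfold Function.uncurry
          fun_prop
        rw [← lintegral_const_mul' _ _ ENNReal.ofReal_ne_top]
        apply lintegral_congr; intro v
        rw [lintegral_V_smul _ (by positivity) (fun x => Tk ε s γ f v (v + x)) (by fun_prop)]
        congr 1
        exact lintegral_add_left_eq_self (μ := volume) (fun v' => Tk ε s γ f v v') v
    _ = _ := by
        rw [Finset.sum_const, Finset.card_range, nsmul_eq_mul, ENNReal.ofReal_mul hK0.le, ENNReal.ofReal_natCast, mul_assoc (K : ℝ≥0∞)]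

lemma proj_norm {n : ℕ} (ω x : V n) (hω : ‖ω‖ = 1) :
    ‖x - ⟪ω, x⟫ • ω‖ ^ 2 = ‖x‖ ^ 2 - ⟪ω, x⟫ ^ 2 := by
  rw [norm_sub_sq_real, inner_smul_right, norm_smul, hω, real_inner_comm x ω]
  simp only [mul_one, norm_eq_abs, sq_abs]
  ring

lemma proj_norm_le {n : ℕ} (ω x : V n) (hω : ‖ω‖ = 1) :
    ‖x - ⟪ω, x⟫ • ω‖ ≤ ‖x‖ := by
  have := proj_norm ω x hω
  apply (pow_le_pow_iff_left₀ (norm_nonneg _) (norm_nonneg _) two_ne_zero).1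
  nlinarith [sq_nonneg ⟪ω, x⟫]

/-- transversality: bounds on `μ q`. -/
lemma muq_bounds {n : ℕ} {R δ ε : ℝ} (hδ : 0 < δ) (hεδ : ε ≤ δ / 2) (hε1 : ε ≤ 1)
    {vs ws ω ω' v' v'' : V n} (hvs : ‖vs‖ ≤ R) (hws : ‖ws‖ ≤ R) (hω : ‖ω‖ = 1) (hω' : ‖ω'‖ = 1)
    {l m q : ℝ} (hl : 0 < l) (hm : 0 < m) (hq : 0 ≤ q) (hq2 : q ^ 2 = 1 - ⟪ω, ω'⟫ ^ 2)
    (hv' : v' = vs + l • ω) (hv'' : v'' = ws + m • ω') (hg : goodP R δ v' vs ws)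
    (hd : ‖v'' - v'‖ ≤ ε) : δ / 2 ≤ m * q ∧ m * q ≤ 1 + 2 * R ∧ δ < l := by
  obtain ⟨-, -, hg3, hg4⟩ := hg
  have ha : v' - vs = l • ω := by rw [hv']; abel
  rw [ha, norm_smul, hω, mul_one, norm_eq_abs, abs_of_pos hl] at hg3 hg4
  rw [inner_smul_left] at hg4
  simp only [conj_trivial] at hg4
  have h1 : δ ^ 2 < ‖ws - v'‖ ^ 2 - ⟪ω, ws - v'⟫ ^ 2 := by
    have : l ^ 2 * δ ^ 2 < l ^ 2 * (‖ws - v'‖ ^ 2 - ⟪ω, ws - v'⟫ ^ 2) := by linarith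
    exact lt_of_mul_lt_mul_left this (by positivity)
  rw [← proj_norm ω _ hω] at h1
  have h2 : δ < ‖(ws - v') - ⟪ω, ws - v'⟫ • ω‖ := lt_of_pow_lt_pow_left₀ 2 (norm_nonneg _) h1
  have h3 : ‖ω' - ⟪ω, ω'⟫ • ω‖ = q := by
    have := proj_norm ω ω' hω
    rw [hω', one_pow, ← hq2] at this
    exact (pow_left_inj₀ (norm_nonneg _) hq two_ne_zero).1 this
  have h4 : ‖m • (ω' - ⟪ω, ω'⟫ • ω)‖ = m * q := by
    rw [norm_smul, h3, norm_eq_abs, abs_of_pos hm]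
  have h5 := proj_norm_le ω (v'' - v') hω
  refine ⟨?_, ?_, hg3⟩
  · have e : (ws - v') - ⟪ω, ws - v'⟫ • ω = ((v'' - v') - ⟪ω, v'' - v'⟫ • ω) - m • (ω' - ⟪ω, ω'⟫ • ω) := by
      have : ws - v' = (v'' - v') - m • ω' := by rw [hv'']; abel
      rw [this, inner_sub_right, inner_smul_right]; module
    rw [e] at h2
    have := norm_sub_le ((v'' - v') - ⟪ω, v'' - v'⟫ • ω) (m • (ω' - ⟪ω, ω'⟫ • ω))
    rw [h4] at this
    linarith
  · have e : m • (ω' - ⟪ω, ω'⟫ • ω) = ((v'' - v') - ⟪ω, v'' - v'⟫ • ω) + ((vs - ws) - ⟪ω, vs - ws⟫ • ω) := by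
      have hh : m • ω' = (v'' - v') + (vs - ws) + l • ω := by rw [hv'', hv']; abel
      have h6 : m * ⟪ω, ω'⟫ = ⟪ω, v'' - v'⟫ + ⟪ω, vs - ws⟫ + l := by
        rw [← inner_smul_right, hh, inner_add_right, inner_add_right, inner_smul_right,
          real_inner_self_eq_norm_sq, hω]; ring
      rw [smul_sub, smul_smul, h6, hh]; module
    rw [← h4, e]
    have h7 := proj_norm_le ω (vs - ws) hω
    have h8 := norm_sub_le vs ws
    refine (norm_add_le _ _).trans ?_
    linarith

set_option maxHeartbeats 1000000 in
lemma core_geom (j : ℕ) (s γ R δ : ℝ) (hδ : 0 < δ) (hR : 0 < R) :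
    ∃ ε : ℝ, 0 < ε ∧ ε ≤ 1 ∧ ε ≤ δ / 2 ∧ ∃ A : ℝ, 0 < A ∧ ∃ C : ℝ, 0 < C ∧
    ∀ vs ws ω ω' v' v'' : V (j+2), ‖ω‖ = 1 → ‖ω'‖ = 1 →
    ∀ l m q : ℝ, 0 < l → 0 < m → 0 < q → q ^ 2 = 1 - ⟪ω, ω'⟫ ^ 2 →
    v' = vs + l • ω → v'' = ws + m • ω' → goodP R δ v' vs ws → anisoDist v' v'' ≤ ε →
    ∀ e y u : V (j+2), ‖e‖ = 1 → ⟪ω, e⟫ = 0 → ⟪ω', e⟫ = q → ⟪ω, y⟫ = 0 → ⟪ω', y⟫ = 0 →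
      ‖y‖ ≤ anisoDist v' v'' → u = v' + (⟪v'' - v', ω'⟫ / q) • e + y →
      vpr u vs ω = v' ∧ vpr u ws ω' = v'' ∧ condK R δ u vs ω ∧ condK R δ u ws ω' ∧
      ‖u - v'‖ + ‖u - v''‖ ≤ A * anisoDist v' v'' ∧
      l ^ (j+1) * m ^ (j+1) * (jap v' * jap v'') ^ ((γ + 2 * s + 1) / 2) ≤
        C * (q⁻¹ * jap u ^ (γ + 2 * s + 2 * ((j:ℝ) + 1))) := by
  set A0 := 2 * (2 + R) / δ + 1 with hA0
  have hA00 : 1 ≤ A0 := by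
    have : 0 < 2 * (2 + R) / δ := by positivity
    linarith
  set ε := min 1 (δ / 2) / (A0 + 1) with hε
  have hmin : 0 < min 1 (δ / 2) := by positivity
  have hε0 : 0 < ε := by positivity
  have hεA : (A0 + 1) * ε = min 1 (δ/2) := by rw [hε]; field_simp
  have hεm : ε ≤ min 1 (δ/2) := by nlinarith
  have hε1 : ε ≤ 1 := hεm.trans (min_le_left _ _)
  have hεδ : ε ≤ δ/2 := hεm.trans (min_le_right _ _)
  set a := (γ + 2 * s + 1) / 2 with ha
  set A1 := 2 * (1 + R) / δ + 1 with hA1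
  refine ⟨ε, hε0, hε1, hεδ, 2 * A0 + 1, by positivity,
    (3 * (1 + R)) ^ (2 * (j+1)) * 9 ^ |a| * ((1 + 2 * R) * 3 * A1), by positivity, ?_⟩
  intro vs ws ω ω' v' v'' hω hω' l m q hl hm hq hq2 hv' hv'' hg hd e y u he hωe hω'e hωy hω'y hy hu
  have hvs := hg.1
  have hws := hg.2.1
  set d := anisoDist v' v'' with hdd
  have hd0 : 0 ≤ d := aniso_nonneg _ _
  have hnd : ‖v'' - v'‖ ≤ d := by rw [norm_sub_rev]; exact norm_le_aniso _ _
  obtain ⟨hmq1, hmq2, hlδ⟩ := muq_bounds hδ hεδ hε1 hvs hws hω hω' hl hm hq.le hq2 hv' hv'' hg (hnd.trans hd)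
  have hq1 : q ≤ 1 := by nlinarith [sq_nonneg ⟪ω, ω'⟫]
  have hmδ : δ / 2 ≤ m := by nlinarith
  -- bound on t
  have hin : |⟪v'' - v', ω'⟫| * m ≤ (2 + R) * d := by
    have e1 : ⟪v'' - v', ω'⟫ * m = ⟪v'' - v', v''⟫ - ⟪v'' - v', ws⟫ := by
      rw [← inner_sub_right, show v'' - ws = m • ω' by rw [hv'']; abel, inner_smul_right]; ring
    have e2 : ⟪v'' - v', v''⟫ = ((‖v''‖^2 - ‖v'‖^2) + ‖v'' - v'‖^2) / 2 := by
      rw [norm_sub_sq_real, inner_sub_left, real_inner_self_eq_norm_sq, real_inner_comm v' v'']; ring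
    rw [show |⟪v'' - v', ω'⟫| * m = |⟪v'' - v', ω'⟫ * m| by rw [abs_mul, abs_of_pos hm], e1, e2]
    have h1 := abs_le.1 (abs_le_aniso v' v'')
    have h2 := abs_le.1 (abs_real_inner_le_norm (v'' - v') ws)
    have h3 : ‖v'' - v'‖ * ‖ws‖ ≤ d * R := by gcongr
    have h4 : ‖v'' - v'‖ ^ 2 ≤ d := by nlinarith [norm_nonneg (v'' - v')]
    have h5 := sq_nonneg ‖v'' - v'‖
    rw [abs_le]
    constructor <;> nlinarith [h1.1, h1.2, h2.1, h2.2]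
  set t := ⟪v'' - v', ω'⟫ / q with ht
  have htb : |t| ≤ 2 * (2 + R) / δ * d := by
    rw [ht, abs_div, abs_of_pos hq, div_le_iff₀ hq]
    have h1 : |⟪v'' - v', ω'⟫| * m ≤ (2 * (2 + R) / δ * d * q) * m := by
      calc _ ≤ (2 + R) * d := hin
        _ = 2 * (2 + R) / δ * d * (δ / 2) := by field_simp
        _ ≤ 2 * (2 + R) / δ * d * (m * q) := by gcongr
        _ = _ := by ring
    exact le_of_mul_le_mul_right h1 hm
  have huv' : ‖u - v'‖ ≤ A0 * d := by
    have : u - v' = t • e + y := by rw [hu]; abel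
    rw [this]
    refine (norm_add_le _ _).trans ?_
    rw [norm_smul, he, mul_one, norm_eq_abs, hA0]
    linarith
  have huv'' : ‖u - v''‖ ≤ (A0 + 1) * d := by
    have : u - v'' = (u - v') - (v'' - v') := by abel
    rw [this]
    refine (norm_sub_le _ _).trans ?_
    linarith
  have hAd : (A0 + 1) * d ≤ min 1 (δ/2) := by rw [← hεA]; gcongr
  have hAd1 := hAd.trans (min_le_left _ _)
  have hAd2 := hAd.trans (min_le_right _ _)
  have hi1 : ⟪u - vs, ω⟫ = l := by
    have : u - vs = l • ω + t • e + y := by rw [hu, hv']; abel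
    rw [this, inner_add_left, inner_add_left, inner_smul_left, inner_smul_left,
      real_inner_self_eq_norm_sq, hω, real_inner_comm ω e, real_inner_comm ω y, hωe, hωy]
    simp
  have hi2 : ⟪u - ws, ω'⟫ = m := by
    have h1 : u - ws = (v'' - ws) - (v'' - v') + t • e + y := by rw [hu]; abel
    have h2 : v'' - ws = m • ω' := by rw [hv'']; abel
    rw [h1, inner_add_left, inner_add_left, inner_sub_left, h2, inner_smul_left, inner_smul_left,
      real_inner_self_eq_norm_sq, hω', real_inner_comm ω' e, real_inner_comm ω' y, hω'e, hω'y, ht]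
    simp only [conj_trivial]
    field_simp; ring
  have hp1 : vpr u vs ω = v' := by unfold vpr; rw [hi1, hv']
  have hp2 : vpr u ws ω' = v'' := by unfold vpr; rw [hi2, hv'']
  refine ⟨hp1, hp2, ⟨hvs, by rw [hi1]; linarith, by rw [hi1, hp1]; linarith⟩,
    ⟨hws, by rw [hi2]; linarith, by rw [hi2, hp2]; linarith⟩, by linarith, ?_⟩
  have j1 := jap_pos v'
  have j2 := jap_pos v''
  have j3 := jap_pos u
  have k1 := jap_le_of_near v' u (by rw [norm_sub_rev]; linarith)
  have k2 := jap_le_of_near v'' u (by rw [norm_sub_rev]; linarith)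
  have k3 := jap_le_of_near u v' (by linarith)
  have k4 := jap_le_of_near u v'' (by linarith)
  have hlu : l ≤ 3 * (1 + R) * jap u := by
    have h1 : ‖v' - vs‖ = l := by
      rw [show v' - vs = l • ω by rw [hv']; abel, norm_smul, hω, norm_eq_abs, abs_of_pos hl, mul_one]
    have h2 := norm_sub_le v' vs
    have h3 : R ≤ R * jap v' := le_mul_of_one_le_right hR.le (one_le_jap v')
    have h4 : (1 + R) * jap v' ≤ (1 + R) * (3 * jap u) := by gcongr
    linarith [norm_le_jap v']
  have hmn : ‖v'' - ws‖ = m := by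
    rw [show v'' - ws = m • ω' by rw [hv'']; abel, norm_smul, hω', norm_eq_abs, abs_of_pos hm, mul_one]
  have hmu : m ≤ 3 * (1 + R) * jap u := by
    have h2 := norm_sub_le v'' ws
    have h3 : R ≤ R * jap v'' := le_mul_of_one_le_right hR.le (one_le_jap v'')
    have h4 : (1 + R) * jap v'' ≤ (1 + R) * (3 * jap u) := by gcongr
    linarith [norm_le_jap v'']
  have hju : jap u ≤ (1 + 2 * R) * 3 * A1 * q⁻¹ := by
    have h1 : ‖v''‖ ≤ ‖ws‖ + m := by
      have := norm_add_le ws (v'' - ws); rw [hmn] at this; simpa using this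
    have h2 := jap_le v''
    have h3 : 1 + R ≤ 2 * (1 + R) / δ * m := by
      calc 1 + R = 2 * (1 + R) / δ * (δ / 2) := by field_simp
        _ ≤ _ := by gcongr
    have h4 : jap u ≤ 3 * A1 * m := by rw [hA1]; linarith
    rw [← div_eq_mul_inv, le_div_iff₀ hq]
    calc jap u * q ≤ 3 * A1 * m * q := by gcongr
      _ = 3 * A1 * (m * q) := by ring
      _ ≤ 3 * A1 * (1 + 2 * R) := by gcongr
      _ = _ := by ring
  have hw : (jap v' * jap v'')^a ≤ 9^|a| * (jap u * jap u)^a := by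
    apply rpow_comparable a (by positivity) (by positivity) (by norm_num)
    · calc _ ≤ (3 * jap u) * (3 * jap u) := by gcongr
        _ = _ := by ring
    · calc _ ≤ (3 * jap v') * (3 * jap v'') := by gcongr
        _ = _ := by ring
  have hju2 : (jap u * jap u)^a = jap u ^ (γ + 2 * s) * jap u := by
    rw [← sq, ← rpow_natCast, ← rpow_mul j3.le]
    conv_rhs => rw [← rpow_one (jap u), ← rpow_mul j3.le, ← rpow_add j3]
    congr 1; rw [ha]; push_cast; ring
  have hju3 : jap u ^ (γ + 2 * s + 2 * ((j:ℝ) + 1)) = jap u ^ (γ + 2 * s) * jap u ^ (2 * (j+1)) := by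
    rw [rpow_add j3, ← rpow_natCast]; push_cast; rfl
  calc l ^ (j+1) * m ^ (j+1) * (jap v' * jap v'') ^ a
      ≤ (3 * (1 + R) * jap u) ^ (j+1) * (3 * (1 + R) * jap u) ^ (j+1) *
        (9^|a| * (jap u * jap u)^a) := by gcongr
    _ = (3 * (1 + R)) ^ (2 * (j+1)) * 9 ^ |a| * (jap u ^ (γ + 2 * s) * jap u ^ (2 * (j+1))) * jap u := by
        rw [hju2, ← pow_add, mul_pow, show j + 1 + (j + 1) = 2 * (j + 1) by ring]; ring
    _ ≤ (3 * (1 + R)) ^ (2 * (j+1)) * 9 ^ |a| * (jap u ^ (γ + 2 * s) * jap u ^ (2 * (j+1))) * ((1 + 2 * R) * 3 * A1 * q⁻¹) := by gcongr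
    _ = _ := by rw [hju3]; ring

open Classical in
def Jk {n : ℕ} (α M R δ : ℝ) (u vs ws ω ω' : V n) : ℝ≥0∞ :=
  if condK R δ u vs ω ∧ condK R δ u ws ω' then
    ENNReal.ofReal (jap u ^ α * (‖u - vpr u vs ω‖ + ‖u - vpr u ws ω'‖) ^ (-M)) else 0

@[fun_prop]
lemma measurable_Jk {n : ℕ} (α M R δ : ℝ) {X : Type*} [MeasurableSpace X] {a b c d e : X → V n}
    (ha : Measurable a) (hb : Measurable b) (hc : Measurable c) (hd : Measurable d)
    (he : Measurable e) :
    Measurable (fun x => Jk α M R δ (a x) (b x) (c x) (d x) (e x)) := by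
  unfold Jk
  exact Measurable.ite ((measurableSet_condK R δ ha hb hd).inter (measurableSet_condK R δ ha hc he))
    (by fun_prop) measurable_const

def Gk {n : ℕ} (α M R δ : ℝ) (f : V n → ℝ) (u vs ws ω ω' : V n) : ℝ≥0∞ :=
  Jk α M R δ u vs ws ω ω' * ENNReal.ofReal ((f (vpr u vs ω) - f (vpr u ws ω')) ^ 2)

@[fun_prop]
lemma measurable_Gk {n : ℕ} (α M R δ : ℝ) {f : V n → ℝ} (hf : Measurable f)
    {X : Type*} [MeasurableSpace X] {a b c d e : X → V n}
    (ha : Measurable a) (hb : Measurable b) (hc : Measurable c) (hd : Measurable d)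
    (he : Measurable e) :
    Measurable (fun x => Gk α M R δ f (a x) (b x) (c x) (d x) (e x)) := by
  unfold Gk
  fun_prop

lemma core_pointwise (j : ℕ) (s γ R δ : ℝ) (hs : 0 < s) (hδ : 0 < δ) (hR : 0 < R) :
    ∃ ε : ℝ, 0 < ε ∧ ε ≤ 1 ∧ ε ≤ δ / 2 ∧ ∃ C : ℝ, 0 < C ∧
    ∀ f : V (j+2) → ℝ, Measurable f →
    ∀ vs ws ω ω' : V (j+2), ‖ω‖ = 1 → ‖ω'‖ = 1 →
    ∀ l m q : ℝ, 0 < l → 0 < m → 0 < q → q ^ 2 = 1 - ⟪ω, ω'⟫ ^ 2 →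
    ∀ e : V (j+2), ∀ L : V j →ₗᵢ[ℝ] V (j+2), ‖e‖ = 1 → ⟪ω, e⟫ = 0 → ⟪ω', e⟫ = q →
      (∀ z, ⟪ω, L z⟫ = 0) → (∀ z, ⟪ω', L z⟫ = 0) →
      ENNReal.ofReal (l ^ (j+1)) * (ENNReal.ofReal (m ^ (j+1)) *
        (goodI R δ (vs + l • ω) vs ws * Tk ε s γ f (vs + l • ω) (ws + m • ω'))) ≤
      ENNReal.ofReal C * ∫⁻ z : V j, ENNReal.ofReal (q⁻¹) *
        Gk (γ + 2 * s + 2 * ((j:ℝ) + 1)) (2 * ((j:ℝ) + 1) + 2 * s) R δ f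
          (vs + l • ω + (⟪(ws + m • ω') - (vs + l • ω), ω'⟫ / q) • e + L z) vs ws ω ω' := by
  obtain ⟨ε, hε0, hε1, hεδ, A, hA, C, hC, H⟩ := core_geom j s γ R δ hδ hR
  refine ⟨ε, hε0, hε1, hεδ, ?_⟩
  set M := 2 * ((j:ℝ) + 1) + 2 * s with hM
  have hM0 : 0 < M := by positivity
  set α := γ + 2 * s + 2 * ((j:ℝ) + 1) with hα
  set κ := (volume (closedBall (0 : V j) 1)).toReal with hκ
  have hκt : volume (closedBall (0 : V j) 1) ≠ ⊤ := measure_closedBall_lt_top.ne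
  have hκ0 : 0 < κ := ENNReal.toReal_pos (measure_closedBall_pos _ _ one_pos).ne' hκt
  have hκe : volume (closedBall (0 : V j) 1) = ENNReal.ofReal κ := (ENNReal.ofReal_toReal hκt).symm
  refine ⟨C * A ^ M * κ⁻¹, by positivity, ?_⟩
  intro f hf vs ws ω ω' hω hω' l m q hl hm hq hq2 e L he hωe hω'e hωL hω'L
  set v' := vs + l • ω with hv'
  set v'' := ws + m • ω' with hv''
  by_cases hg : goodP R δ v' vs ws
  swap
  · simp [goodI, hg]
  by_cases hd : anisoDist v' v'' ≤ ε
  swap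
  · simp [Tk, hd]
  by_cases hne : v' = v''
  · have : Tk ε s γ f v' v'' = 0 := by rw [← hne]; simp [Tk]
    rw [this]; simp
  have hd0 : 0 < anisoDist v' v'' :=
    lt_of_lt_of_le (norm_pos_iff.2 (sub_ne_zero.2 hne)) (norm_le_aniso _ _)
  simp only [goodI, Tk, if_pos hg, if_pos hd, one_mul]
  set d := anisoDist v' v'' with hdd
  set w := (jap v' * jap v'') ^ ((γ + 2 * s + 1) / 2) with hw
  have hw0 : 0 < w := rpow_pos_of_pos (mul_pos (jap_pos _) (jap_pos _)) _
  set Q := C⁻¹ * (l ^ (j+1) * m ^ (j+1) * w) * (A * d) ^ (-M) * (f v'' - f v') ^ 2 with hQ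
  have hQ0 : 0 ≤ Q := by positivity
  have key : ∀ z ∈ closedBall (0 : V j) d, ENNReal.ofReal Q ≤ ENNReal.ofReal (q⁻¹) *
        Gk α M R δ f (v' + (⟪v'' - v', ω'⟫ / q) • e + L z) vs ws ω ω' := by
    intro z hz
    have hz' : ‖L z‖ ≤ d := by rw [L.norm_map]; simpa using hz
    obtain ⟨p1, p2, c1, c2, hA2, hC2⟩ := H vs ws ω ω' v' v'' hω hω' l m q hl hm hq hq2 hv' hv'' hg hd
      e (L z) _ he hωe hω'e (hωL z) (hω'L z) hz' rfl
    set u := v' + (⟪v'' - v', ω'⟫ / q) • e + L z with hu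
    have hju := jap_pos u
    unfold Gk Jk
    rw [if_pos ⟨c1, c2⟩, p1, p2, ← ENNReal.ofReal_mul (by positivity), ← ENNReal.ofReal_mul (by positivity)]
    apply ENNReal.ofReal_le_ofReal
    have hr0 : 0 < ‖u - v'‖ + ‖u - v''‖ := by
      have h1 : 0 < ‖v' - v''‖ := norm_pos_iff.2 (sub_ne_zero.2 hne)
      have h2 := norm_sub_le (u - v'') (u - v')
      rw [show u - v'' - (u - v') = v' - v'' by abel] at h2
      linarith
    have h3 : (A * d) ^ (-M) ≤ (‖u - v'‖ + ‖u - v''‖) ^ (-M) :=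
      rpow_le_rpow_of_nonpos hr0 hA2 (by linarith)
    calc Q ≤ C⁻¹ * (C * (q⁻¹ * jap u ^ α)) * (‖u - v'‖ + ‖u - v''‖) ^ (-M) * (f v'' - f v') ^ 2 := by
          rw [hQ]; gcongr
      _ = _ := by field_simp; ring
  calc ENNReal.ofReal (l ^ (j+1)) * (ENNReal.ofReal (m ^ (j+1)) *
        ENNReal.ofReal (w * (f v'' - f v') ^ 2 * d ^ (-(((j+2:ℕ):ℝ) + 2 * s))))
      = ENNReal.ofReal (C * A ^ M * κ⁻¹) * (ENNReal.ofReal Q * volume (closedBall (0 : V j) d)) := by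
        rw [Measure.addHaar_closedBall' _ _ hd0.le, hκe]
        rw [← ENNReal.ofReal_mul (by positivity), ← ENNReal.ofReal_mul (by positivity),
          ← ENNReal.ofReal_mul (by positivity), ← ENNReal.ofReal_mul (by positivity),
          ← ENNReal.ofReal_mul (by positivity)]
        congr 1
        have e1 : d ^ (-(((j+2:ℕ):ℝ) + 2 * s)) = d ^ (-M) * d ^ j := by
          rw [← rpow_natCast d j, ← rpow_add hd0]; congr 1; rw [hM]; push_cast; ring
        have e2 : (A * d) ^ (-M) = (A ^ M)⁻¹ * d ^ (-M) := by
          rw [mul_rpow hA.le hd0.le, rpow_neg hA.le]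
        have hAM : 0 < A ^ M := by positivity
        simp only [finrank_euclideanSpace, Fintype.card_fin]
        rw [e1, hQ, e2]
        field_simp
    _ ≤ _ := by
        refine mul_le_mul' le_rfl ?_
        rw [← setLIntegral_const]
        refine (setLIntegral_mono' measurableSet_closedBall key).trans ?_
        exact setLIntegral_le_lintegral _ _

lemma core_angles (j : ℕ) (s γ R δ : ℝ) (hs : 0 < s) (hδ : 0 < δ) (hR : 0 < R) :
    ∃ ε : ℝ, 0 < ε ∧ ∃ C : ℝ, 0 < C ∧
    ∀ f : V (j+2) → ℝ, Measurable f →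
    ∀ vs ws ω ω' : V (j+2), ‖ω‖ = 1 → ‖ω'‖ = 1 →
      ∫⁻ l in Ioi (0:ℝ), ∫⁻ m in Ioi (0:ℝ),
        ENNReal.ofReal (l ^ (j+1)) * (ENNReal.ofReal (m ^ (j+1)) *
        (goodI R δ (vs + l • ω) vs ws * Tk ε s γ f (vs + l • ω) (ws + m • ω'))) ≤
      ENNReal.ofReal C * ∫⁻ u : V (j+2), 
        Gk (γ + 2 * s + 2 * ((j:ℝ) + 1)) (2 * ((j:ℝ) + 1) + 2 * s) R δ f u vs ws ω ω' := by
  obtain ⟨ε, hε0, hε1, hεδ, C, hC, H⟩ := core_pointwise j s γ R δ hs hδ hR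
  refine ⟨ε, hε0, C, hC, ?_⟩
  intro f hf vs ws ω ω' hω hω'
  have habs : ⟪ω, ω'⟫ ^ 2 ≤ 1 := by
    have := abs_real_inner_le_norm ω ω'
    rw [hω, hω', mul_one] at this
    rw [← sq_abs]; nlinarith [abs_nonneg ⟪ω, ω'⟫]
  set q := √(1 - ⟪ω, ω'⟫ ^ 2) with hq
  have hq2 : q ^ 2 = 1 - ⟪ω, ω'⟫ ^ 2 := Real.sq_sqrt (by linarith)
  have hq0 : 0 ≤ q := Real.sqrt_nonneg _
  clear_value q
  rcases hq0.eq_or_lt with h0 | hq0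
  · have : ∀ l ∈ Ioi (0:ℝ), ∀ m ∈ Ioi (0:ℝ), 
        ENNReal.ofReal (l ^ (j+1)) * (ENNReal.ofReal (m ^ (j+1)) *
        (goodI R δ (vs + l • ω) vs ws * Tk ε s γ f (vs + l • ω) (ws + m • ω'))) = 0 := by
      intro l hl m hm
      by_cases hg : goodP R δ (vs + l • ω) vs ws
      swap
      · simp [goodI, hg]
      by_cases hd : anisoDist (vs + l • ω) (ws + m • ω') ≤ ε
      swap
      · simp [Tk, hd]
      exfalso
      have := (muq_bounds hδ hεδ hε1 hg.1 hg.2.1 hω hω' hl hm h0.le hq2 rfl rfl hg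
        (by rw [norm_sub_rev]; exact (norm_le_aniso _ _).trans hd)).1
      rw [← h0] at this
      linarith
    rw [setLIntegral_congr_fun measurableSet_Ioi (g := fun _ => 0)]
    · simp
    · intro l hl
      beta_reduce
      rw [setLIntegral_congr_fun measurableSet_Ioi (g := fun _ => 0)]
      · simp
      · intro m hm; exact this l hl m hm
  · obtain ⟨e, L, he, hωe, hω'e, hωL, -, hω'L, hIntg⟩ := two_plane ω ω' hω hω' q hq0 hq2
    set G : V (j+2) → ℝ≥0∞ := fun u => 
        Gk (γ + 2 * s + 2 * ((j:ℝ) + 1)) (2 * ((j:ℝ) + 1) + 2 * s) R δ f u vs ws ω ω' with hG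
    have hGm : Measurable G := by fun_prop
    have e1 : ∫⁻ u, G u = ∫⁻ l : ℝ, ∫⁻ m : ℝ, ∫⁻ z : V j, ENNReal.ofReal (q⁻¹) *
        G (vs + l • ω + (⟪(ws + m • ω') - (vs + l • ω), ω'⟫ / q) • e + L z) := by
      rw [← lintegral_add_left_eq_self (μ := volume) G vs, hIntg (fun u => G (vs + u)) (by fun_prop)]
      apply lintegral_congr; intro l
      rw [← lintegral_add_right_eq_self (μ := volume) _ ⟪ws - vs, ω'⟫]
      apply lintegral_congr; intro m
      apply lintegral_congr; intro z
      have e2 : ⟪(ws + m • ω') - (vs + l • ω), ω'⟫ = m + ⟪ws - vs, ω'⟫ - ⟪ω, ω'⟫ * l := by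
        rw [show (ws + m • ω') - (vs + l • ω) = (ws - vs) + m • ω' - l • ω by abel, inner_sub_left,
          inner_add_left, inner_smul_left, inner_smul_left, real_inner_self_eq_norm_sq, hω']
        simp only [conj_trivial]
        ring
      rw [e2]
      simp only [add_assoc]
    rw [e1, ← lintegral_const_mul' _ _ ENNReal.ofReal_ne_top]
    refine le_trans ?_ (setLIntegral_le_lintegral (Ioi 0) _)
    refine setLIntegral_mono' measurableSet_Ioi ?_
    intro l hl
    rw [← lintegral_const_mul' _ _ ENNReal.ofReal_ne_top]
    refine le_trans ?_ (setLIntegral_le_lintegral (Ioi 0) _)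
    refine setLIntegral_mono' measurableSet_Ioi ?_
    intro m hm
    exact H f hf vs ws ω ω' hω hω' l m q hl hm hq0 hq2 e L he hωe hω'e hωL hω'L

lemma polar_two {j : ℕ} (H : V (j+2) → ℝ≥0∞) (hH : Measurable H) : ∫⁻ x, H x =
    ∫⁻ ω : sphere (0 : V (j+2)) 1, (∫⁻ r in Ioi (0:ℝ),
      ENNReal.ofReal (r ^ (j+1)) * H (r • (ω : V (j+2)))) ∂(sphMeas (j+2)) :=
  lintegral_polar (m := j+1) H hH

lemma double_polar {j : ℕ} (h : V (j+2) → V (j+2) → ℝ≥0∞)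
    (hmeas : Measurable (fun z : V (j+2) × V (j+2) => h z.1 z.2)) (vs ws : V (j+2)) :
    ∫⁻ v', ∫⁻ v'', h v' v'' = ∫⁻ ω : sphere (0 : V (j+2)) 1, ∫⁻ ω' : sphere (0 : V (j+2)) 1,
      (∫⁻ l in Ioi (0:ℝ), ∫⁻ m in Ioi (0:ℝ), ENNReal.ofReal (l ^ (j+1)) *
        (ENNReal.ofReal (m ^ (j+1)) * h (vs + l • (ω : V (j+2))) (ws + m • (ω' : V (j+2)))))
         ∂(sphMeas (j+2)) ∂(sphMeas (j+2)) := by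
  have hfin : IsFiniteMeasure (sphMeas (j+2)) := by unfold sphMeas; infer_instance
  have hmeas' : ∀ {X : Type} [MeasurableSpace X] (a b : X → V (j+2)), Measurable a → Measurable b →
    Measurable (fun x => h (a x) (b x)) := fun a b ha hb => hmeas.comp (ha.prodMk hb)
  have a1 : ∀ v', ∫⁻ v'', h v' v'' = ∫⁻ ω' : sphere (0 : V (j+2)) 1, (∫⁻ m in Ioi (0:ℝ), 
      ENNReal.ofReal (m ^ (j+1)) * h v' (ws + m • (ω' : V (j+2)))) ∂(sphMeas (j+2)) := by
    intro v'
    rw [← lintegral_add_left_eq_self (μ := volume) (fun v'' => h v' v'') ws]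
    exact polar_two (fun x => h v' (ws + x)) (hmeas' _ _ measurable_const (by fun_prop))
  have hm2 : Measurable (fun p : V (j+2) × sphere (0 : V (j+2)) 1 => ∫⁻ m in Ioi (0:ℝ), 
      ENNReal.ofReal (m ^ (j+1)) * h p.1 (ws + m • (p.2 : V (j+2)))) := by
    refine Measurable.lintegral_prod_right' (f := fun z : (V (j+2) × sphere (0 : V (j+2)) 1) × ℝ => ENNReal.ofReal (z.2 ^ (j+1)) * h z.1.1 (ws + z.2 • (z.1.2 : V (j+2)))) ?_
    exact Measurable.mul (by fun_prop) (hmeas' _ _ (by fun_prop) (by fun_prop))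
  have hm1 : Measurable (fun v' => ∫⁻ ω' : sphere (0 : V (j+2)) 1, (∫⁻ m in Ioi (0:ℝ), 
      ENNReal.ofReal (m ^ (j+1)) * h v' (ws + m • (ω' : V (j+2)))) ∂(sphMeas (j+2))) :=
    Measurable.lintegral_prod_right' hm2
  simp_rw [a1]
  rw [← lintegral_add_left_eq_self (μ := volume) _ vs]
  have hm3 : Measurable (fun x => ∫⁻ ω' : sphere (0 : V (j+2)) 1, (∫⁻ m in Ioi (0:ℝ), 
      ENNReal.ofReal (m ^ (j+1)) * h (vs + x) (ws + m • (ω' : V (j+2)))) ∂(sphMeas (j+2))) :=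
    hm1.comp (measurable_const_add vs)
  rw [polar_two _ hm3]
  apply lintegral_congr; intro ω
  have a2 : ∀ l : ℝ, ENNReal.ofReal (l ^ (j+1)) * ∫⁻ ω' : sphere (0 : V (j+2)) 1, (∫⁻ m in Ioi (0:ℝ), 
      ENNReal.ofReal (m ^ (j+1)) * h (vs + l • (ω : V (j+2))) (ws + m • (ω' : V (j+2)))) ∂(sphMeas (j+2)) =
     ∫⁻ ω' : sphere (0 : V (j+2)) 1, (∫⁻ m in Ioi (0:ℝ), ENNReal.ofReal (l ^ (j+1)) *
      (ENNReal.ofReal (m ^ (j+1)) * h (vs + l • (ω : V (j+2))) (ws + m • (ω' : V (j+2))))) ∂(sphMeas (j+2)) := by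
    intro l
    rw [← lintegral_const_mul' _ _ ENNReal.ofReal_ne_top]
    apply lintegral_congr; intro ω'
    rw [← lintegral_const_mul' _ _ ENNReal.ofReal_ne_top]
  simp_rw [a2]
  rw [lintegral_lintegral_swap]
  refine Measurable.aemeasurable ?_
  unfold Function.uncurry
  refine Measurable.lintegral_prod_right' (f := fun z : (ℝ × sphere (0 : V (j+2)) 1) × ℝ => 
    ENNReal.ofReal (z.1.1 ^ (j+1)) *
      (ENNReal.ofReal (z.2 ^ (j+1)) * h (vs + z.1.1 • (ω : V (j+2))) (ws + z.2 • (z.1.2 : V (j+2))))) ?_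
  exact Measurable.mul (by fun_prop) (Measurable.mul (by fun_prop) (hmeas' _ _ (by fun_prop) (by fun_prop)))

lemma core_integral (j : ℕ) (s γ R δ : ℝ) (hs : 0 < s) (hδ : 0 < δ) (hR : 0 < R) :
    ∃ ε : ℝ, 0 < ε ∧ ∃ C : ℝ, 0 < C ∧
    ∀ f : V (j+2) → ℝ, Measurable f →
    ∀ vs ws : V (j+2), 
      ∫⁻ v' : V (j+2), ∫⁻ v'' : V (j+2), goodI R δ v' vs ws * Tk ε s γ f v' v'' ≤
      ENNReal.ofReal C * ∫⁻ ω : sphere (0 : V (j+2)) 1, ∫⁻ ω' : sphere (0 : V (j+2)) 1,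
       (∫⁻ u : V (j+2), 
        Gk (γ + 2 * s + 2 * ((j:ℝ) + 1)) (2 * ((j:ℝ) + 1) + 2 * s) R δ f u vs ws ω ω')
        ∂(sphMeas (j+2)) ∂(sphMeas (j+2)) := by
  obtain ⟨ε, hε0, C, hC, H⟩ := core_angles j s γ R δ hs hδ hR
  refine ⟨ε, hε0, C, hC, ?_⟩
  intro f hf vs ws
  have hfin : IsFiniteMeasure (sphMeas (j+2)) := by unfold sphMeas; infer_instance
  set h : V (j+2) → V (j+2) → ℝ≥0∞ := fun v' v'' => goodI R δ v' vs ws * Tk ε s γ f v' v'' with hh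
  have hmeas : Measurable (fun z : V (j+2) × V (j+2) => h z.1 z.2) := by
    simp only [hh]; fun_prop
  have e1 := double_polar h hmeas vs ws
  rw [e1, ← lintegral_const_mul' _ _ ENNReal.ofReal_ne_top]
  apply lintegral_mono; intro ω
  beta_reduce
  rw [← lintegral_const_mul' _ _ ENNReal.ofReal_ne_top]
  apply lintegral_mono; intro ω'
  exact H f hf vs ws ω ω' (by simp) (by simp)

lemma swap3 {X Y : Type*} [MeasurableSpace X] [MeasurableSpace Y] (μ : Measure X) (ν : Measure Y)
    [SFinite μ] [SFinite ν] (H : X → X → Y → ℝ≥0∞)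
    (hH : Measurable (fun z : (X × X) × Y => H z.1.1 z.1.2 z.2)) :
    ∫⁻ x, ∫⁻ x', ∫⁻ y, H x x' y ∂ν ∂μ ∂μ = ∫⁻ y, ∫⁻ x, ∫⁻ x', H x x' y ∂μ ∂μ ∂ν := by
  have e1 : ∀ x, ∫⁻ x', ∫⁻ y, H x x' y ∂ν ∂μ = ∫⁻ y, ∫⁻ x', H x x' y ∂μ ∂ν := by
    intro x
    rw [lintegral_lintegral_swap]
    refine Measurable.aemeasurable ?_
    exact hH.comp (f := fun p : X × Y => ((x, p.1), p.2)) (by fun_prop)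
  simp_rw [e1]
  rw [lintegral_lintegral_swap]
  refine Measurable.aemeasurable ?_
  refine Measurable.lintegral_prod_right' (f := fun z : (X × Y) × X => H z.1.1 z.2 z.1.2) ?_
  exact hH.comp (f := fun p : (X × Y) × X => ((p.1.1, p.2), p.1.2)) (by fun_prop)

lemma swap4 {X : Type*} [MeasurableSpace X] (μ : Measure X)
    [SFinite μ] (H : X → X → X → X → ℝ≥0∞)
    (hH : Measurable (fun z : (X × X) × (X × X) => H z.1.1 z.1.2 z.2.1 z.2.2)) :
    ∫⁻ a, ∫⁻ b, ∫⁻ c, ∫⁻ d, H a b c d ∂μ ∂μ ∂μ ∂μ =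
      ∫⁻ c, ∫⁻ d, ∫⁻ a, ∫⁻ b, H a b c d ∂μ ∂μ ∂μ ∂μ := by
  have m1 : Measurable (fun z : X × X => ∫⁻ w : X × X, H z.1 z.2 w.1 w.2 ∂(μ.prod μ)) :=
    Measurable.lintegral_prod_right' hH
  have m2 : Measurable (fun w : X × X => ∫⁻ z : X × X, H z.1 z.2 w.1 w.2 ∂(μ.prod μ)) :=
    Measurable.lintegral_prod_left' hH
  have e1 : ∀ a b, ∫⁻ c, ∫⁻ d, H a b c d ∂μ ∂μ = ∫⁻ w : X × X, H a b w.1 w.2 ∂(μ.prod μ) := by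
    intro a b
    rw [lintegral_prod]
    exact (hH.comp (f := fun p : X × X => ((a, b), p)) (by fun_prop)).aemeasurable
  have e2 : ∀ c d, ∫⁻ a, ∫⁻ b, H a b c d ∂μ ∂μ = ∫⁻ w : X × X, H w.1 w.2 c d ∂(μ.prod μ) := by
    intro c d
    rw [lintegral_prod]
    exact (hH.comp (f := fun p : X × X => (p, (c, d))) (by fun_prop)).aemeasurable
  simp_rw [e1, e2]
  have e3 := lintegral_prod (μ := μ) (ν := μ) _ m1.aemeasurable
  have e4 := lintegral_prod (μ := μ) (ν := μ) _ m2.aemeasurable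
  beta_reduce at e3 e4
  rw [← e3, ← e4, lintegral_lintegral_swap]
  exact hH.aemeasurable

lemma Jk_symm {n : ℕ} (α M R δ : ℝ) (u vs ws ω ω' : V n) :
    Jk α M R δ u vs ws ω ω' = Jk α M R δ u ws vs ω' ω := by
  unfold Jk
  by_cases h1 : condK R δ u vs ω <;> by_cases h2 : condK R δ u ws ω' <;> simp [h1, h2, add_comm]

lemma Jk_integral (j : ℕ) (s γ R δ : ℝ) (hs : 0 < s) (hδ : 0 < δ) (hR : 0 < R) :
    ∃ C : ℝ, 0 < C ∧ ∀ f : V (j+2) → ℝ, ∀ u vs ws ω : V (j+2),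
      ∫⁻ ω' : sphere (0 : V (j+2)) 1,
        Jk (γ + 2 * s + 2 * ((j:ℝ) + 1)) (2 * ((j:ℝ) + 1) + 2 * s) R δ u vs ws ω ω' *
          ENNReal.ofReal ((f u - f (vpr u vs ω)) ^ 2) ∂(sphMeas (j+2)) ≤
      ENNReal.ofReal C * (Kk (γ + ((j:ℝ)+1+2*s)) ((j:ℝ)+1+2*s) R δ u vs ω *
          ENNReal.ofReal ((f u - f (vpr u vs ω)) ^ 2)) := by
  obtain ⟨C, hC, H⟩ := omega_integral j s R δ hs hδ hR
  refine ⟨C, hC, ?_⟩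
  intro f u vs ws ω
  by_cases hc : condK R δ u vs ω
  swap
  · simp [Jk, hc]
  by_cases hu : u = vpr u vs ω
  · simp [← hu]
  have hr : 0 < ‖u - vpr u vs ω‖ := norm_pos_iff.2 (sub_ne_zero.2 hu)
  rw [lintegral_mul_const' _ _ ENNReal.ofReal_ne_top, ← mul_assoc]
  refine mul_le_mul' ?_ le_rfl
  have hj := jap_pos u
  have h1 := H u ws _ hr
  calc _ = ∫⁻ ω' : sphere (0 : V (j+2)) 1, ENNReal.ofReal (jap u ^ (γ + ((j:ℝ)+1+2*s))) *
        (open Classical in if condK R δ u ws ω' then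
        ENNReal.ofReal (jap u ^ (j+1) * (‖u - vpr u vs ω‖ + ‖u - vpr u ws ω'‖) ^ (-(2 * ((j:ℝ) + 1) + 2 * s)))
        else 0) ∂(sphMeas (j+2)) := by
        apply lintegral_congr; intro ω'
        unfold Jk
        by_cases h2 : condK R δ u ws ω'
        · rw [if_pos ⟨hc, h2⟩, if_pos h2, ← ENNReal.ofReal_mul (by positivity), ← mul_assoc,
            ← rpow_natCast (jap u), ← rpow_add hj]
          congr 3; push_cast; ring_nf
        · rw [if_neg (fun h => h2 h.2), if_neg h2, mul_zero]
    _ ≤ ENNReal.ofReal (jap u ^ (γ + ((j:ℝ)+1+2*s))) *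
        ENNReal.ofReal (C * ‖u - vpr u vs ω‖ ^ (-((j:ℝ) + 1 + 2 * s))) := by
        rw [lintegral_const_mul' _ _ ENNReal.ofReal_ne_top]
        exact mul_le_mul' le_rfl h1
    _ = _ := by
        unfold Kk
        rw [if_pos hc, ← ENNReal.ofReal_mul (by positivity), ← ENNReal.ofReal_mul (by positivity)]
        congr 1; ring

/-- the dissipation density. -/
def Bk (j : ℕ) (s γ R δ : ℝ) (f : V (j+2) → ℝ) (u vs : V (j+2)) : ℝ≥0∞ :=
  ∫⁻ ω : sphere (0 : V (j+2)) 1,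
    Kk (γ + ((j:ℝ)+1+2*s)) ((j:ℝ)+1+2*s) R δ u vs ω *
          ENNReal.ofReal ((f u - f (vpr u vs ω)) ^ 2) ∂(sphMeas (j+2))

lemma measurable_Bk (j : ℕ) (s γ R δ : ℝ) {f : V (j+2) → ℝ} (hf : Measurable f) :
    Measurable (fun z : V (j+2) × V (j+2) => Bk j s γ R δ f z.1 z.2) := by
  have hfin : IsFiniteMeasure (sphMeas (j+2)) := by unfold sphMeas; infer_instance
  refine Measurable.lintegral_prod_right' (f := fun z : (V (j+2) × V (j+2)) × sphere (0 : V (j+2)) 1 =>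
    Kk (γ + ((j:ℝ)+1+2*s)) ((j:ℝ)+1+2*s) R δ z.1.1 z.1.2 z.2 *
          ENNReal.ofReal ((f z.1.1 - f (vpr z.1.1 z.1.2 z.2)) ^ 2)) ?_
  fun_prop

lemma Gk_integral (j : ℕ) (s γ R δ : ℝ) (hs : 0 < s) (hδ : 0 < δ) (hR : 0 < R) :
    ∃ C : ℝ, 0 < C ∧ ∀ f : V (j+2) → ℝ, Measurable f → ∀ vs ws : V (j+2),
      ∫⁻ ω : sphere (0 : V (j+2)) 1, ∫⁻ ω' : sphere (0 : V (j+2)) 1,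
       (∫⁻ u : V (j+2),
        Gk (γ + 2 * s + 2 * ((j:ℝ) + 1)) (2 * ((j:ℝ) + 1) + 2 * s) R δ f u vs ws ω ω')
        ∂(sphMeas (j+2)) ∂(sphMeas (j+2)) ≤
      ENNReal.ofReal C * ((∫⁻ u, Bk j s γ R δ f u vs) + ∫⁻ u, Bk j s γ R δ f u ws) := by
  obtain ⟨C, hC, H⟩ := Jk_integral j s γ R δ hs hδ hR
  have hfin : IsFiniteMeasure (sphMeas (j+2)) := by unfold sphMeas; infer_instance
  refine ⟨2 * C, by positivity, ?_⟩
  intro f hf vs ws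
  set α := γ + 2 * s + 2 * ((j:ℝ) + 1)
  set M := 2 * ((j:ℝ) + 1) + 2 * s
  rw [swap3 (sphMeas (j+2)) volume (fun ω ω' u => Gk α M R δ f u vs ws ω ω') (by fun_prop)]
  have hB : ∀ vs, Measurable (fun u => Bk j s γ R δ f u vs) := fun vs =>
    (measurable_Bk j s γ R δ hf).comp (f := fun u => (u, vs)) (by fun_prop)
  rw [← lintegral_add_left (hB vs), ← lintegral_const_mul' _ _ ENNReal.ofReal_ne_top]
  apply lintegral_mono; intro u
  let P : sphere (0 : V (j+2)) 1 → sphere (0 : V (j+2)) 1 → ℝ≥0∞ := fun ω ω' =>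
    Jk α M R δ u vs ws ω ω' * ENNReal.ofReal ((f u - f (vpr u vs ω)) ^ 2)
  let Q : sphere (0 : V (j+2)) 1 → sphere (0 : V (j+2)) 1 → ℝ≥0∞ := fun ω ω' =>
    Jk α M R δ u ws vs ω' ω * ENNReal.ofReal ((f u - f (vpr u ws ω')) ^ 2)
  have hP : Measurable (fun z : sphere (0 : V (j+2)) 1 × sphere (0 : V (j+2)) 1 => P z.1 z.2) := by
    simp only [P]; fun_prop
  have hQ : Measurable (fun z : sphere (0 : V (j+2)) 1 × sphere (0 : V (j+2)) 1 => Q z.1 z.2) := by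
    simp only [Q]; fun_prop
  have hP1 : ∫⁻ ω, ∫⁻ ω', P ω ω' ∂(sphMeas (j+2)) ∂(sphMeas (j+2)) ≤ ENNReal.ofReal C * Bk j s γ R δ f u vs := by
    unfold Bk
    rw [← lintegral_const_mul' _ _ ENNReal.ofReal_ne_top]
    apply lintegral_mono; intro ω
    exact H f u vs ws ω
  have hQ1 : ∫⁻ ω, ∫⁻ ω', Q ω ω' ∂(sphMeas (j+2)) ∂(sphMeas (j+2)) ≤ ENNReal.ofReal C * Bk j s γ R δ f u ws := by
    rw [lintegral_lintegral_swap hQ.aemeasurable]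
    unfold Bk
    rw [← lintegral_const_mul' _ _ ENNReal.ofReal_ne_top]
    apply lintegral_mono; intro ω
    exact H f u ws vs ω
  calc ∫⁻ ω : sphere (0 : V (j+2)) 1, ∫⁻ ω' : sphere (0 : V (j+2)) 1, Gk α M R δ f u vs ws ω ω' ∂(sphMeas (j+2)) ∂(sphMeas (j+2))
     ≤ ∫⁻ ω, ∫⁻ ω', ENNReal.ofReal 2 * (P ω ω' + Q ω ω') ∂(sphMeas (j+2)) ∂(sphMeas (j+2)) := by
        apply lintegral_mono; intro ω; apply lintegral_mono; intro ω'
        simp only [P, Q, Gk]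
        rw [Jk_symm α M R δ u ws vs, ← mul_add, mul_left_comm]
        refine mul_le_mul' le_rfl ?_
        rw [← ENNReal.ofReal_add (by positivity) (by positivity), ← ENNReal.ofReal_mul (by norm_num)]
        apply ENNReal.ofReal_le_ofReal
        nlinarith [sq_nonneg ((f u - f (vpr u vs ω)) + (f u - f (vpr u ws ω')))]
    _ = ENNReal.ofReal 2 * (∫⁻ ω, ∫⁻ ω', P ω ω' ∂(sphMeas (j+2)) ∂(sphMeas (j+2)) + ∫⁻ ω, ∫⁻ ω', Q ω ω' ∂(sphMeas (j+2)) ∂(sphMeas (j+2))) := by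
        rw [← lintegral_add_left (Measurable.lintegral_prod_right' hP), ← lintegral_const_mul' _ _ ENNReal.ofReal_ne_top]
        apply lintegral_congr; intro ω
        rw [lintegral_const_mul' _ _ ENNReal.ofReal_ne_top, lintegral_add_left]
        exact hP.comp (f := fun x => (ω, x)) (by fun_prop)
    _ ≤ ENNReal.ofReal 2 * (ENNReal.ofReal C * Bk j s γ R δ f u vs + ENNReal.ofReal C * Bk j s γ R δ f u ws) := by
        gcongr
    _ = _ := by
        rw [← mul_add, ← mul_assoc, ← ENNReal.ofReal_mul (by norm_num)]

lemma assembly {n : ℕ} (hn : 2 ≤ n) {R δ Cg : ℝ} (hδ : 0 < δ) {g : V n → ℝ}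
    (hg : Measurable g) (hL : AssumptionL R δ Cg g)
    (T : V n → V n → ℝ≥0∞) (hT : Measurable (fun z : V n × V n => T z.1 z.2))
    (A : V n → ℝ≥0∞) (hA : Measurable A) (D : ℝ≥0∞)
    (h : ∀ vs ws, ∫⁻ v, ∫⁻ v', goodI R δ v vs ws * T v v' ≤ D * (A vs + A ws)) :
    ENNReal.ofReal Cg ^ 2 * ∫⁻ v, ∫⁻ v', T v v' ≤
      2 * D * ((∫⁻ x in closedBall (0 : V n) R, ENNReal.ofReal (g x)) *
        ∫⁻ vs, ENNReal.ofReal (g vs) * A vs) := by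
  let G : V n → ℝ≥0∞ := (closedBall (0 : V n) R).indicator (fun x => ENNReal.ofReal (g x))
  have hG : Measurable G := (by fun_prop : Measurable (fun x => ENNReal.ofReal (g x))).indicator
    measurableSet_closedBall
  have hGtop : ∀ x, G x ≠ ⊤ := by
    intro x
    by_cases hx : x ∈ closedBall (0 : V n) R
    · simp only [G]; rw [indicator_of_mem hx]; exact ENNReal.ofReal_ne_top
    · simp only [G]; rw [indicator_of_notMem hx]; exact ENNReal.zero_ne_top
  have hGle : ∀ x, G x ≤ ENNReal.ofReal (g x) := fun x => indicator_le_self _ _ x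
  have hmass : ∀ v, ENNReal.ofReal Cg ^ 2 ≤ ∫⁻ vs, ∫⁻ ws, G vs * (G ws * goodI R δ v vs ws) := by
    intro v
    refine (good_mass hn hδ hg hL v).trans (le_of_eq ?_)
    apply lintegral_congr; intro vs; apply lintegral_congr; intro ws
    by_cases hp : goodP R δ v vs ws
    · have h1 : vs ∈ closedBall (0 : V n) R := by simpa using hp.1
      have h2 : ws ∈ closedBall (0 : V n) R := by simpa using hp.2.1
      simp only [G]
      rw [indicator_of_mem h1, indicator_of_mem h2]
    · simp [goodI, hp]
  have hGA : Measurable (fun x => G x * A x) := hG.mul hA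
  have hT1 : Measurable (fun v => ∫⁻ v', T v v') := Measurable.lintegral_prod_right' hT
  have hT2 : ∀ v, Measurable (fun v' => T v v') := fun v => hT.comp (f := fun x => (v, x)) (by fun_prop)
  have hgI : ∀ v, Measurable (fun z : V n × V n => G z.1 * (G z.2 * goodI R δ v z.1 z.2)) := by
    intro v; fun_prop
  calc ENNReal.ofReal Cg ^ 2 * ∫⁻ v, ∫⁻ v', T v v'
      = ∫⁻ v, ∫⁻ v', ENNReal.ofReal Cg ^ 2 * T v v' := by
        rw [← lintegral_const_mul _ hT1]
        apply lintegral_congr; intro v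
        rw [lintegral_const_mul _ (hT2 v)]
    _ ≤ ∫⁻ v, ∫⁻ v', (∫⁻ vs, ∫⁻ ws, G vs * (G ws * goodI R δ v vs ws)) * T v v' := by
        apply lintegral_mono; intro v; apply lintegral_mono; intro v'
        exact mul_le_mul' (hmass v) le_rfl
    _ = ∫⁻ v, ∫⁻ v', ∫⁻ vs, ∫⁻ ws, G vs * (G ws * (goodI R δ v vs ws * T v v')) := by
        apply lintegral_congr; intro v; apply lintegral_congr; intro v'
        rw [← lintegral_mul_const _ (Measurable.lintegral_prod_right' (hgI v))]
        apply lintegral_congr; intro vs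
        have m3 : Measurable (fun ws => G vs * (G ws * goodI R δ v vs ws)) := by fun_prop
        beta_reduce
        rw [← lintegral_mul_const _ m3]
        apply lintegral_congr; intro ws
        simp only [mul_assoc]
    _ = ∫⁻ vs, ∫⁻ ws, ∫⁻ v, ∫⁻ v', G vs * (G ws * (goodI R δ v vs ws * T v v')) := by
        refine swap4 volume (fun v v' vs ws => G vs * (G ws * (goodI R δ v vs ws * T v v'))) ?_
        have hT3 : Measurable (fun z : (V n × V n) × (V n × V n) => T z.1.1 z.1.2) :=
          hT.comp (f := fun z : (V n × V n) × (V n × V n) => z.1) (by fun_prop)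
        fun_prop
    _ = ∫⁻ vs, ∫⁻ ws, G vs * (G ws * ∫⁻ v, ∫⁻ v', goodI R δ v vs ws * T v v') := by
        apply lintegral_congr; intro vs; apply lintegral_congr; intro ws
        rw [← lintegral_const_mul' _ _ (hGtop ws), ← lintegral_const_mul' _ _ (hGtop vs)]
        apply lintegral_congr; intro v
        rw [← lintegral_const_mul' _ _ (hGtop ws), ← lintegral_const_mul' _ _ (hGtop vs)]
    _ ≤ ∫⁻ vs, ∫⁻ ws, G vs * (G ws * (D * (A vs + A ws))) := by
        apply lintegral_mono; intro vs; apply lintegral_mono; intro ws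
        exact mul_le_mul' le_rfl (mul_le_mul' le_rfl (h vs ws))
    _ = ∫⁻ vs, (D * (∫⁻ ws, G ws) * (G vs * A vs) + D * (∫⁻ ws, G ws * A ws) * G vs) := by
        apply lintegral_congr; intro vs
        have e : ∀ ws, G vs * (G ws * (D * (A vs + A ws))) =
          (D * (G vs * A vs)) * G ws + (D * G vs) * (G ws * A ws) := by intro ws; ring
        simp_rw [e]
        rw [lintegral_add_left (by fun_prop), lintegral_const_mul _ hG, lintegral_const_mul _ hGA]
        ring
    _ = 2 * D * ((∫⁻ ws, G ws) * ∫⁻ ws, G ws * A ws) := by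
        rw [lintegral_add_left (by fun_prop), lintegral_const_mul _ hG, lintegral_const_mul _ hGA]
        ring
    _ ≤ _ := by
        refine mul_le_mul' le_rfl (mul_le_mul' ?_ ?_)
        · exact le_of_eq (lintegral_indicator measurableSet_closedBall _)
        · apply lintegral_mono; intro x
          exact mul_le_mul' (hGle x) le_rfl

/-- **Entropy production estimate** (Theorem 3, coercive part):
`(∫_{B_R} g) · S(g,f) ≥ C · C̃_g² · |√f|²_{Ṅ^{s,γ}}`. -/
theorem entropy_production_estimate
    (n : ℕ) (hn : 2 ≤ n) (s γ CΦ cb R δ : ℝ)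
    (hs : s ∈ Set.Ioo (0:ℝ) 1) (hγ : -(n:ℝ) < γ) (hCΦ : 0 < CΦ) (hcb : 0 < cb)
    (hδ : 0 < δ) (hδR : δ < R) :
    ∃ C : ℝ, 0 < C ∧
      ∀ b : ℝ → ℝ, KernelAssumptions n s cb b →
      ∀ g : V n → ℝ, Measurable g → (∀ v, 0 ≤ g v) →
        (∫⁻ x in Metric.closedBall (0 : V n) R, ENNReal.ofReal (g x)) < ⊤ →
      ∀ Cg : ℝ, 0 < Cg → AssumptionL R δ Cg g →
      ∀ f : V n → ℝ, Measurable f → (∀ v, 0 < f v) →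
        ENNReal.ofReal (C * Cg ^ 2) * NdotSq s γ (fun v => Real.sqrt (f v)) ≤
          (∫⁻ x in Metric.closedBall (0 : V n) R, ENNReal.ofReal (g x)) *
            EntS CΦ γ b g f := by
  obtain ⟨j, rfl⟩ : ∃ j, n = j + 2 := ⟨n - 2, by omega⟩
  have hR : 0 < R := hδ.trans hδR
  have hs0 : 0 < s := hs.1
  obtain ⟨ε, hε, C1, hC1, H1⟩ := core_integral j s γ R δ hs0 hδ hR
  obtain ⟨C2, hC2, H2⟩ := Gk_integral j s γ R δ hs0 hδ hR
  obtain ⟨C3, hC3, H3⟩ := locality (n := j+2) (by omega) ε s γ hs0 hε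
  obtain ⟨c, hc, H4⟩ := EntS_lower j s γ CΦ cb R δ hs0 hCΦ hcb hδ hR
  refine ⟨c / (C3 * (2 * (C1 * C2))), by positivity, ?_⟩
  intro b hb g hg hg0 hgi Cg hCg hL f hf hf0
  let F : V (j+2) → ℝ := fun v => √(f v)
  have hF : Measurable F := by simp only [F]; fun_prop
  have hBm := measurable_Bk j s γ R δ hF
  let A : V (j+2) → ℝ≥0∞ := fun vs => ∫⁻ u, Bk j s γ R δ F u vs
  have hA : Measurable A := Measurable.lintegral_prod_left' hBm
  have key := assembly hn hδ hg hL (Tk ε s γ F) (by fun_prop) A hA (ENNReal.ofReal (C1 * C2)) (by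
    intro vs ws
    refine (H1 F hF vs ws).trans ?_
    rw [ENNReal.ofReal_mul hC1.le, mul_assoc]
    exact mul_le_mul' le_rfl (H2 F hF vs ws))
  have hS : ENNReal.ofReal c * ∫⁻ vs, ENNReal.ofReal (g vs) * A vs ≤ EntS CΦ γ b g f := by
    refine le_trans (le_of_eq ?_) (H4 b hb g hg hg0 f hf hf0)
    congr 1
    have e1 : ∀ vs, ENNReal.ofReal (g vs) * A vs = ∫⁻ u, ENNReal.ofReal (g vs) * Bk j s γ R δ F u vs := by
      intro vs
      rw [lintegral_const_mul' _ _ ENNReal.ofReal_ne_top]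
    simp_rw [e1]
    rw [lintegral_lintegral_swap]
    · rfl
    · refine Measurable.aemeasurable ?_
      exact Measurable.mul (by fun_prop) (hBm.comp (f := fun z : V (j+2) × V (j+2) => (z.2, z.1)) (by fun_prop))
  have hK : (0:ℝ) < C3 * (2 * (C1 * C2)) := by positivity
  have hloc := H3 F hF
  set I := ∫⁻ x in Metric.closedBall (0 : V (j+2)) R, ENNReal.ofReal (g x)
  set X := ∫⁻ v, ∫⁻ v', Tk ε s γ F v v'
  set J := ∫⁻ vs, ENNReal.ofReal (g vs) * A vs
  calc ENNReal.ofReal (c / (C3 * (2 * (C1 * C2))) * Cg ^ 2) * NdotSq s γ F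
      ≤ ENNReal.ofReal (c / (C3 * (2 * (C1 * C2))) * Cg ^ 2) * (ENNReal.ofReal C3 * X) :=
        mul_le_mul' le_rfl hloc
    _ = ENNReal.ofReal (c / (C3 * (2 * (C1 * C2)))) * ENNReal.ofReal C3 * (ENNReal.ofReal Cg ^ 2 * X) := by
        rw [ENNReal.ofReal_mul (by positivity), ENNReal.ofReal_pow hCg.le]; ring
    _ ≤ ENNReal.ofReal (c / (C3 * (2 * (C1 * C2)))) * ENNReal.ofReal C3 *
          (2 * ENNReal.ofReal (C1 * C2) * (I * J)) := mul_le_mul' le_rfl key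
    _ = I * (ENNReal.ofReal c * J) := by
        have e : ENNReal.ofReal c = ENNReal.ofReal (c / (C3 * (2 * (C1 * C2)))) * ENNReal.ofReal C3 *
          (2 * ENNReal.ofReal (C1 * C2)) := by
          rw [show (2:ℝ≥0∞) = ENNReal.ofReal 2 by simp, ← ENNReal.ofReal_mul (p := 2) (by norm_num),
            ← ENNReal.ofReal_mul (p := c / _) (by positivity), ← ENNReal.ofReal_mul (by positivity)]
          congr 1; field_simp
        rw [e]; ring
    _ ≤ I * EntS CΦ γ b g f := mul_le_mul' le_rfl hS
end
end

section
/- Proposition 2.1 (trivial estimate for the loss piece D^k_-). There exists a constant C > 0, depending only on n, s, γ, C_Φ and c_b, such that for every kernel b satisfying the standing kernel assumptions, every measurable g satisfying Assumption U with constant C_g > 0, all measurable f, h : ℝⁿ → ℝ, every k ∈ ℤ, and every measurable χ : ℝ → [0,1] vanishing outside the interval [2^{-k-1}, 2^{-k}], one has ∫∫∫ B(v-v_*,σ) χ(|v'-v|) |g(v_*)| |f(v) h(v)| dσ dv_* dv ≤ C · C_g · 2^{2sk} · |f|_{L²_{γ+2s}} |h|_{L²_{γ+2s}}, as an inequality of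 values in [0,∞]. -/
open MeasureTheory Real Set Metric
open scoped ENNReal RealInnerProductSpace

noncomputable section

/-- the weighted squared `L²` norm `|f|²_{L²_ℓ}`, as a value in `[0,∞]`. -/
def L2e {n : ℕ} (ℓ : ℝ) (f : V n → ℝ) : ℝ≥0∞ :=
  ∫⁻ v : V n, ENNReal.ofReal (jap v ^ ℓ * f v ^ 2)

/-- Assumption U: with `i = 1` for `s ∈ (0,1/2)` and `i = 2` for `s ∈ [1/2,1)`,
`∫ |v-v_*|^a ⟨v_*⟩^i |g(v_*)| dv_* ≤ C_g ⟨v⟩^a` for all `v` and all `a ∈ [γ, γ+2s]`. -/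
def AssumptionU {n : ℕ} (s γ Cg : ℝ) (g : V n → ℝ) : Prop :=
  ∀ v : V n, ∀ a ∈ Set.Icc γ (γ + 2 * s),
    (∫⁻ vs : V n, ENNReal.ofReal
        (‖v - vs‖ ^ a * jap vs ^ (if s < 2⁻¹ then (1:ℝ) else 2) * |g vs|)) ≤
      ENNReal.ofReal (Cg * jap v ^ a)

open scoped Pointwise in
lemma cap_measure (n : ℕ) (u : V n) (hu : ‖u‖ = 1) (ρ : ℝ) (h0 : 0 < ρ) (h4 : ρ ≤ 4) (hn : 2 ≤ n) :
    sphMeas n {σ : Metric.sphere (0 : V n) 1 | ‖(σ : V n) - u‖ ≤ ρ} ≤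
      ENNReal.ofReal (n * ((5 / ρ) * ((2 * ρ) ^ n * (volume (ball (0 : V n) 1)).toReal))) := by
  have hm : MeasurableSet {σ : Metric.sphere (0 : V n) 1 | ‖(σ : V n) - u‖ ≤ ρ} := by
    apply measurableSet_le <;> fun_prop
  rw [sphMeas, Measure.toSphere_apply' _ hm, ENNReal.ofReal_mul (by positivity)]
  simp only [finrank_euclideanSpace, Fintype.card_fin, ENNReal.ofReal_natCast]
  gcongr
  set N := ⌊1 / ρ⌋₊ + 1 with hN
  have hcov : (Ioo (0:ℝ) 1) • (Subtype.val '' {σ : Metric.sphere (0 : V n) 1 | ‖(σ : V n) - u‖ ≤ ρ})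
      ⊆ ⋃ j ∈ Finset.range N, closedBall (((j : ℝ) * ρ) • u) (2 * ρ) := by
    rintro x ⟨t, ⟨ht0, ht1⟩, y, ⟨σ, hσ, rfl⟩, rfl⟩
    simp only [mem_iUnion, Finset.mem_range, mem_closedBall, exists_prop]
    refine ⟨⌊t / ρ⌋₊, ?_, ?_⟩
    · rw [hN, Nat.lt_succ_iff]
      apply Nat.floor_le_floor
      gcongr
    · have h1 : (⌊t / ρ⌋₊ : ℝ) * ρ ≤ t := by
        have := Nat.floor_le (a := t / ρ) (by positivity)
        rwa [le_div_iff₀ h0] at this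
      have h2 : t ≤ (⌊t / ρ⌋₊ : ℝ) * ρ + ρ := by
        have := (Nat.lt_floor_add_one (t / ρ)).le
        rw [div_le_iff₀ h0] at this
        linarith
      rw [dist_eq_norm]
      have e : t • (σ : V n) - ((⌊t / ρ⌋₊ : ℝ) * ρ) • u
          = t • ((σ : V n) - u) + (t - (⌊t / ρ⌋₊ : ℝ) * ρ) • u := by module
      change ‖t • (σ : V n) - ((⌊t / ρ⌋₊ : ℝ) * ρ) • u‖ ≤ _
      rw [e]
      refine (norm_add_le _ _).trans ?_
      rw [norm_smul, norm_smul, hu, Real.norm_of_nonneg ht0.le, Real.norm_of_nonneg (by linarith)]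
      have : ‖(σ : V n) - u‖ ≤ ρ := hσ
      nlinarith [norm_nonneg ((σ : V n) - u)]
  refine (measure_mono hcov).trans ((measure_biUnion_finset_le _ _).trans ?_)
  have hball : ∀ j : ℕ, volume (closedBall (((j : ℝ) * ρ) • u) (2 * ρ)) =
      ENNReal.ofReal ((2 * ρ) ^ n * (volume (ball (0 : V n) 1)).toReal) := by
    intro j
    rw [Measure.addHaar_closedBall _ _ (by positivity), ENNReal.ofReal_mul (by positivity),
      ENNReal.ofReal_toReal measure_ball_lt_top.ne]
    simp
  simp only [hball, Finset.sum_const, Finset.card_range, nsmul_eq_mul]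
  rw [ENNReal.ofReal_mul (p := 5 / ρ) (by positivity)]
  refine mul_le_mul' ?_ le_rfl
  rw [← ENNReal.ofReal_natCast]
  apply ENNReal.ofReal_le_ofReal
  have := Nat.floor_le (a := 1 / ρ) (by positivity)
  rw [hN]; push_cast
  have h5 : 5 / ρ = 1 / ρ + 4 / ρ := by ring
  have h6 : 1 ≤ 4 / ρ := by rwa [le_div_iff₀ h0, one_mul]
  linarith

lemma b_bound (n : ℕ) (hn : 2 ≤ n) (s cb : ℝ) (hs : 0 < s) (hcb : 0 < cb) (b : ℝ → ℝ)
    (hb : KernelAssumptions n s cb b) (u σ : V n) (hu : ‖u‖ = 1) (hσ : ‖σ‖ = 1)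
    (δ : ℝ) (h0 : 0 < δ) (hδ : δ ≤ ‖σ - u‖) :
    b ⟪u, σ⟫ ≤ cb⁻¹ * δ ^ (-(1 + 2 * s)) * (2 / δ) ^ (n - 2) := by
  obtain ⟨-, hb0, hb1, hb2⟩ := hb
  have hpos : 0 ≤ cb⁻¹ * δ ^ (-(1 + 2 * s)) * (2 / δ) ^ (n - 2) := by positivity
  have hin : |⟪u, σ⟫| ≤ 1 := by
    have := abs_real_inner_le_norm u σ
    rwa [hu, hσ, one_mul] at this
  have hcos : Real.cos (Real.arccos ⟪u, σ⟫) = ⟪u, σ⟫ :=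
    Real.cos_arccos (by linarith [(abs_le.1 hin).1]) (abs_le.1 hin).2
  set θ := Real.arccos ⟪u, σ⟫ with hθ
  have hd : ‖σ - u‖ ^ 2 = 2 - 2 * Real.cos θ := by
    rw [norm_sub_sq_real, hu, hσ, hcos, real_inner_comm]; ring
  have hδ2 : δ ^ 2 ≤ 2 - 2 * Real.cos θ := by
    rw [← hd]; gcongr
  have hθ0 : 0 ≤ θ := Real.arccos_nonneg _
  have hδθ : δ ≤ θ := by
    have := Real.one_sub_sq_div_two_le_cos (x := θ)
    by_contra! hlt
    nlinarith
  rw [← hcos]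
  rcases lt_or_ge (π / 2) θ with hc | hc
  · rw [hb1 θ ⟨hc, Real.arccos_le_pi _⟩]; exact hpos
  have hk := (hb2 θ ⟨by linarith, hc⟩).2
  have hcn : 0 ≤ Real.cos θ := Real.cos_nonneg_of_mem_Icc ⟨by linarith [Real.pi_pos], hc⟩
  have hsn : 0 ≤ Real.sin θ := Real.sin_nonneg_of_nonneg_of_le_pi hθ0 (Real.arccos_le_pi _)
  have hsd : δ / 2 ≤ Real.sin θ := by
    have h1 := Real.sin_sq_add_cos_sq θ
    have h2 : (δ / 2) ^ 2 ≤ Real.sin θ ^ 2 := by nlinarith [Real.cos_le_one θ]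
    exact (pow_le_pow_iff_left₀ (by positivity) hsn (by norm_num)).1 h2
  have he : ((n : ℝ) - 2) = ((n - 2 : ℕ) : ℝ) := by push_cast [hn]; ring
  rw [he, Real.rpow_natCast] at hk
  have h1 : (δ / 2) ^ (n - 2) * b (Real.cos θ) ≤ cb⁻¹ * δ ^ (-(1 + 2 * s)) := by
    refine le_trans ?_ (hk.trans ?_)
    · have := hb0 (Real.cos θ)
      gcongr
    · gcongr ?_ * ?_
      exact Real.rpow_le_rpow_of_nonpos h0 hδθ (by linarith)
  have h2 : b (Real.cos θ) = ((δ / 2) ^ (n - 2) * b (Real.cos θ)) * (2 / δ) ^ (n - 2) := by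
    rw [mul_right_comm, ← mul_pow]
    field_simp
    simp
  rw [h2]
  gcongr

def Kc (n : ℕ) (cb : ℝ) : ℝ :=
  cb⁻¹ * 2 ^ (n - 2) * (n * (5 / 2) * 4 ^ n * (volume (ball (0 : V n) 1)).toReal)

lemma sphere_bound (n : ℕ) (hn : 2 ≤ n) (s cb : ℝ) (hs : 0 < s) (hcb : 0 < cb) (b : ℝ → ℝ)
    (hb : KernelAssumptions n s cb b) (u : V n) (hu : ‖u‖ = 1) (δ : ℝ) (h0 : 0 < δ)
    (χ : V n → ℝ) (hχ : ∀ σ, χ σ ∈ Icc (0:ℝ) 1)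
    (hχ0 : ∀ σ : V n, ‖σ - u‖ ∉ Icc δ (2 * δ) → χ σ = 0) :
    (∫⁻ σ : Metric.sphere (0 : V n) 1, ENNReal.ofReal (b ⟪u, (σ : V n)⟫ * χ σ) ∂(sphMeas n)) ≤
      ENNReal.ofReal (Kc n cb * δ ^ (-(2 * s))) := by
  have hn1 : ∀ σ : Metric.sphere (0 : V n) 1, ‖(σ : V n)‖ = 1 := fun σ => by simp
  rcases lt_or_ge 2 δ with h2 | h2
  · have : ∀ σ : Metric.sphere (0 : V n) 1, χ σ = 0 := by
      intro σ
      apply hχ0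
      intro h
      have := norm_sub_le (σ : V n) u
      rw [hn1, hu] at this
      linarith [h.1]
    simp [this]
  set M := cb⁻¹ * δ ^ (-(1 + 2 * s)) * (2 / δ) ^ (n - 2) with hM
  set S := {σ : Metric.sphere (0 : V n) 1 | ‖(σ : V n) - u‖ ≤ 2 * δ} with hS
  have hmono : (∫⁻ σ : Metric.sphere (0 : V n) 1, ENNReal.ofReal (b ⟪u, (σ : V n)⟫ * χ σ) ∂(sphMeas n))
      ≤ ∫⁻ σ, S.indicator (fun _ => ENNReal.ofReal M) σ ∂(sphMeas n) := by
    apply lintegral_mono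
    intro σ
    by_cases h : ‖(σ : V n) - u‖ ∈ Icc δ (2 * δ)
    · have hσ : σ ∈ S := h.2
      simp only [indicator_of_mem hσ]
      apply ENNReal.ofReal_le_ofReal
      calc b ⟪u, (σ : V n)⟫ * χ σ ≤ b ⟪u, (σ : V n)⟫ * 1 :=
            mul_le_mul_of_nonneg_left (hχ σ).2 (hb.2.1 _)
        _ ≤ M := by
          rw [mul_one]; exact b_bound n hn s cb hs hcb b hb u σ hu (hn1 σ) δ h0 h.1
    · simp [hχ0 _ h]
  refine hmono.trans ((lintegral_indicator_const_le _ _).trans ?_)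
  refine (mul_le_mul_right (cap_measure n u hu (2 * δ) (by positivity) (by linarith) hn) _).trans ?_
  rw [← ENNReal.ofReal_mul (by positivity)]
  apply ENNReal.ofReal_le_ofReal
  apply le_of_eq
  obtain ⟨m, rfl⟩ : ∃ m, n = m + 2 := ⟨n - 2, by omega⟩
  have e : δ ^ (-(1 + 2 * s)) = δ ^ (-(2 * s)) * δ⁻¹ := by
    rw [show -(1 + 2 * s) = -(2 * s) + -1 by ring, Real.rpow_add h0, Real.rpow_neg_one]
  rw [hM, e, Kc]
  simp only [Nat.add_sub_cancel]
  generalize δ ^ (-(2 * s)) = A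
  rw [show 2 * (2 * δ) = 4 * δ by ring, mul_pow, div_pow]
  field_simp
  ring

lemma inner_bound (n : ℕ) (hn : 2 ≤ n) (s γ CΦ cb : ℝ) (hs : 0 < s) (hCΦ : 0 < CΦ) (hcb : 0 < cb)
    (b : ℝ → ℝ) (hb : KernelAssumptions n s cb b) (k : ℤ) (χ : ℝ → ℝ)
    (hχ : ∀ t, χ t ∈ Set.Icc (0:ℝ) 1)
    (hχ0 : ∀ t : ℝ, t ∉ Set.Icc ((2:ℝ) ^ (-k - 1)) ((2:ℝ) ^ (-k)) → χ t = 0)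
    (v vs : V n) (G F : ℝ) (hG : 0 ≤ G) (hF : 0 ≤ F) :
    (∫⁻ σ : Metric.sphere (0 : V n) 1,
      ENNReal.ofReal (Bker CΦ γ b v vs σ * χ ‖vprime v vs σ - v‖ * G * F) ∂(sphMeas n)) ≤
      ENNReal.ofReal (CΦ * Kc n cb * (2:ℝ) ^ (2 * s * (k:ℝ)) * F) *
        ENNReal.ofReal (‖v - vs‖ ^ (γ + 2 * s) * G) := by
  have hK : 0 ≤ Kc n cb := by unfold Kc; positivity
  rcases eq_or_ne v vs with rfl | hne
  · have h0 : ∀ σ : V n, vprime v v σ - v = 0 := by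
      intro σ
      simp only [vprime, sub_self, norm_zero, zero_div, zero_smul, add_zero]
      module
    have : χ 0 = 0 := hχ0 0 (fun h => absurd h.1 (not_le.2 (by positivity)))
    simp [h0, this]
  set r := ‖v - vs‖ with hr
  have hr0 : 0 < r := norm_pos_iff.2 (sub_ne_zero.2 hne)
  set u : V n := r⁻¹ • (v - vs) with hu
  have hu1 : ‖u‖ = 1 := by
    rw [hu, norm_smul, norm_inv, Real.norm_of_nonneg hr0.le, ← hr, inv_mul_cancel₀ hr0.ne']
  have hv : ∀ σ : V n, ‖vprime v vs σ - v‖ = r / 2 * ‖σ - u‖ := by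
    intro σ
    have : vprime v vs σ - v = (r / 2) • (σ - u) := by
      rw [vprime, ← hr, smul_sub, hu, smul_smul]
      have : r / 2 * r⁻¹ = 2⁻¹ := by field_simp
      rw [this]
      module
    rw [this, norm_smul, Real.norm_of_nonneg (by positivity)]
  set δ : ℝ := (2:ℝ) ^ (-k) / r with hδ
  have hδ0 : 0 < δ := by positivity
  have key := sphere_bound n hn s cb hs hcb b hb u hu1 δ hδ0 (fun σ => χ (r / 2 * ‖σ - u‖))
    (fun σ => hχ _) (by
      intro σ h
      apply hχ0
      contrapose! h
      have e : (2:ℝ) ^ (-k - 1) = 2 ^ (-k) / 2 := by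
        rw [zpow_sub_one₀ (by norm_num)]; rfl
      have e2 : (2:ℝ) ^ (-k) = δ * r := by rw [hδ]; field_simp
      rw [e, e2] at h
      obtain ⟨h1, h2⟩ := h
      constructor
      · by_contra! hc
        nlinarith
      · by_contra! hc
        nlinarith)
  have hA : 0 ≤ CΦ * r ^ γ * G * F := by positivity
  calc (∫⁻ σ : Metric.sphere (0 : V n) 1,
      ENNReal.ofReal (Bker CΦ γ b v vs σ * χ ‖vprime v vs σ - v‖ * G * F) ∂(sphMeas n))
      = ∫⁻ σ : Metric.sphere (0 : V n) 1, ENNReal.ofReal (CΦ * r ^ γ * G * F) *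
          ENNReal.ofReal (b ⟪u, (σ : V n)⟫ * χ (r / 2 * ‖(σ : V n) - u‖)) ∂(sphMeas n) := by
        apply lintegral_congr
        intro σ
        rw [← ENNReal.ofReal_mul hA, hv, Bker, ← hr, ← hu]
        congr 1
        ring
    _ = ENNReal.ofReal (CΦ * r ^ γ * G * F) * ∫⁻ σ : Metric.sphere (0 : V n) 1,
          ENNReal.ofReal (b ⟪u, (σ : V n)⟫ * χ (r / 2 * ‖(σ : V n) - u‖)) ∂(sphMeas n) :=
        lintegral_const_mul' _ _ ENNReal.ofReal_ne_top
    _ ≤ ENNReal.ofReal (CΦ * r ^ γ * G * F) * ENNReal.ofReal (Kc n cb * δ ^ (-(2 * s))) := by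
        gcongr
    _ = _ := by
        rw [← ENNReal.ofReal_mul hA, ← ENNReal.ofReal_mul (by positivity)]
        congr 1
        have e1 : δ ^ (-(2 * s)) = (2:ℝ) ^ (2 * s * (k:ℝ)) * r ^ (2 * s) := by
          rw [hδ, Real.div_rpow (by positivity) hr0.le, Real.rpow_neg hr0.le, div_inv_eq_mul,
            ← Real.rpow_intCast, ← Real.rpow_mul (by norm_num)]
          congr 2
          push_cast; ring
        rw [e1, Real.rpow_add hr0]
        ring

/-- Proposition 2.1 (trivial estimate for the loss piece `D^k_-`). -/
theorem trivial_estimate_loss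
    (n : ℕ) (hn : 2 ≤ n) (s γ CΦ cb : ℝ)
    (hs : s ∈ Set.Ioo (0:ℝ) 1) (hγ : -(n:ℝ) < γ) (hCΦ : 0 < CΦ) (hcb : 0 < cb) :
    ∃ C : ℝ, 0 < C ∧
      ∀ b : ℝ → ℝ, KernelAssumptions n s cb b →
      ∀ g : V n → ℝ, Measurable g →
      ∀ Cg : ℝ, 0 < Cg → AssumptionU s γ Cg g →
      ∀ f h : V n → ℝ, Measurable f → Measurable h →
      ∀ k : ℤ, ∀ χ : ℝ → ℝ, Measurable χ → (∀ t, χ t ∈ Set.Icc (0:ℝ) 1) →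
        (∀ t : ℝ, t ∉ Set.Icc ((2:ℝ) ^ (-k - 1)) ((2:ℝ) ^ (-k)) → χ t = 0) →
        (∫⁻ v : V n, ∫⁻ vs : V n, ∫⁻ σ : Metric.sphere (0 : V n) 1,
            ENNReal.ofReal (Bker CΦ γ b v vs σ * χ ‖vprime v vs σ - v‖ *
              |g vs| * |f v * h v|) ∂(sphMeas n)) ≤
          ENNReal.ofReal (C * Cg * (2:ℝ) ^ (2 * s * (k:ℝ))) *
            L2e (γ + 2 * s) f ^ (2⁻¹ : ℝ) * L2e (γ + 2 * s) h ^ (2⁻¹ : ℝ) := by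
  obtain ⟨hs0, hs1⟩ := hs
  have hK : 0 ≤ Kc n cb := by unfold Kc; positivity
  refine ⟨CΦ * Kc n cb + 1, by positivity, ?_⟩
  intro b hb g hg Cg hCg hU f h hf hh k χ hχm hχ hχ0
  have hjm : Measurable (fun v : V n => jap v) := by unfold jap; fun_prop
  have hj1 : ∀ v : V n, 1 ≤ jap v := by
    intro v
    rw [jap, Real.one_le_sqrt]
    nlinarith [sq_nonneg ‖v‖]
  have hj0 : ∀ v : V n, 0 < jap v := fun v => lt_of_lt_of_le one_pos (hj1 v)
  set ℓ := γ + 2 * s with hℓ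
  set T : ℝ := (2:ℝ) ^ (2 * s * (k:ℝ)) with hT
  have hT0 : 0 < T := by positivity
  have step : ∀ v : V n, (∫⁻ vs : V n, ∫⁻ σ : Metric.sphere (0 : V n) 1,
            ENNReal.ofReal (Bker CΦ γ b v vs σ * χ ‖vprime v vs σ - v‖ *
              |g vs| * |f v * h v|) ∂(sphMeas n)) ≤
      ENNReal.ofReal ((CΦ * Kc n cb + 1) * Cg * T) *
        (ENNReal.ofReal (jap v ^ (ℓ / 2) * |f v|) * ENNReal.ofReal (jap v ^ (ℓ / 2) * |h v|)) := by
    intro v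
    calc _ ≤ ∫⁻ vs : V n, ENNReal.ofReal (CΦ * Kc n cb * T * |f v * h v|) *
        ENNReal.ofReal (‖v - vs‖ ^ ℓ * |g vs|) := by
          apply lintegral_mono
          intro vs
          exact inner_bound n hn s γ CΦ cb hs0 hCΦ hcb b hb k χ hχ hχ0 v vs _ _
            (abs_nonneg _) (abs_nonneg _)
      _ = ENNReal.ofReal (CΦ * Kc n cb * T * |f v * h v|) *
          ∫⁻ vs : V n, ENNReal.ofReal (‖v - vs‖ ^ ℓ * |g vs|) :=
        lintegral_const_mul' _ _ ENNReal.ofReal_ne_top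
      _ ≤ ENNReal.ofReal (CΦ * Kc n cb * T * |f v * h v|) * ENNReal.ofReal (Cg * jap v ^ ℓ) := by
        gcongr
        refine le_trans ?_ (hU v ℓ ⟨by linarith, le_rfl⟩)
        apply lintegral_mono
        intro vs
        apply ENNReal.ofReal_le_ofReal
        have h1 : 1 ≤ jap vs ^ (if s < 2⁻¹ then (1:ℝ) else 2) :=
          Real.one_le_rpow (hj1 vs) (by split_ifs <;> norm_num)
        have h2 : 0 ≤ ‖v - vs‖ ^ ℓ := by positivity
        gcongr
        exact le_mul_of_one_le_right h2 h1
      _ ≤ _ := by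
        have hjv := hj0 v
        have e : jap v ^ ℓ = jap v ^ (ℓ / 2) * jap v ^ (ℓ / 2) := by
          rw [← Real.rpow_add hjv]; congr 1; ring
        rw [← ENNReal.ofReal_mul (by positivity), ← ENNReal.ofReal_mul (by positivity),
          ← ENNReal.ofReal_mul (by positivity)]
        apply ENNReal.ofReal_le_ofReal
        rw [e, abs_mul]
        have : 0 ≤ Cg * T * (jap v ^ (ℓ / 2) * |f v|) * (jap v ^ (ℓ / 2) * |h v|) := by positivity
        linarith
  refine (lintegral_mono step).trans ?_
  rw [lintegral_const_mul' _ _ ENNReal.ofReal_ne_top]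
  refine le_of_le_of_eq (mul_le_mul' le_rfl ?_) (mul_assoc _ _ _).symm
  have hL : ∀ F : V n → ℝ,
      (∫⁻ v : V n, ENNReal.ofReal (jap v ^ (ℓ / 2) * |F v|) ^ (2:ℝ)) = L2e ℓ F := by
    intro F
    apply lintegral_congr
    intro v
    have hjv := hj0 v
    rw [ENNReal.ofReal_rpow_of_nonneg (by positivity) (by norm_num)]
    congr 1
    rw [Real.rpow_two, mul_pow, sq_abs, ← Real.rpow_natCast, ← Real.rpow_mul hjv.le]
    congr 2
    push_cast; ring
  have hold := ENNReal.lintegral_mul_le_Lp_mul_Lq (volume : Measure (V n))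
    (p := 2) (q := 2) Real.HolderConjugate.two_two
    (f := fun v => ENNReal.ofReal (jap v ^ (ℓ / 2) * |f v|))
    (g := fun v => ENNReal.ofReal (jap v ^ (ℓ / 2) * |h v|))
    (by fun_prop) (by fun_prop)
  rw [hL, hL, one_div] at hold
  exact hold
end
end
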